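/- arXiv:0905.2707 — 4 statements merged into one kernel-verified Lean document; each statement's English description precedes it below -/
import Mathlib

section
/- Let C ⊆ ℝ^{r+1} be a polyhedral cone with dim C = r + 1 (i.e. C has nonempty topological interior), and let f : C → ℝ be a superlinear function such that for every 2-dimensional linear subspace H ⊆ ℝ^{r+1} the restriction of f to H ∩ C is piecewise linear. Then f is piecewise linear on C. -/
/-- A polyhedral cone in `ℝⁿ`: the set of nonnegative real combinations of finitely many
vectors. -/
def IsPolyhedralCone {n : ℕ} (C : Set (Fin n → ℝ)) : Prop :=
  ∃ (k : ℕ) (v : Fin k → Fin n → ℝ),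
    C = {x | ∃ c : Fin k → ℝ, (∀ i, 0 ≤ c i) ∧ x = ∑ i, c i • v i}

/-- A function is piecewise linear on a set `C` if `C` admits a finite decomposition into
polyhedral cones on each of which the function agrees with a linear function. -/
def IsPiecewiseLinearOn {n : ℕ} (f : (Fin n → ℝ) → ℝ) (C : Set (Fin n → ℝ)) : Prop :=
  ∃ (m : ℕ) (D : Fin m → Set (Fin n → ℝ)),
    (∀ i, IsPolyhedralCone (D i)) ∧ C = ⋃ i, D i ∧
    ∀ i, ∃ ℓ : (Fin n → ℝ) →ₗ[ℝ] ℝ, ∀ x ∈ D i, f x = ℓ x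

section RadiallyAffine

variable {V : Type*} [AddCommGroup V] [Module ℝ V]

/-- The cone cut out by finitely many linear inequalities `0 ≤ φ x`. -/
def halfspaceCone (Φ : Finset (V →ₗ[ℝ] ℝ)) : Set V := {x | ∀ φ ∈ Φ, 0 ≤ φ x}

/-- Superlinear functions on `C` that are affine near the base point of every ray which starts
at a point of `C` and has direction in `C`. -/
structure IsRadiallyAffine (f : V → ℝ) (C : Set V) : Prop where
  add_le : ∀ x ∈ C, ∀ y ∈ C, f x + f y ≤ f (x + y)
  map_smul : ∀ x ∈ C, ∀ a : ℝ, 0 < a → f (a • x) = a * f x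
  radial : ∀ x ∈ C, ∀ y ∈ C, ∃ ε : ℝ, 0 < ε ∧ ∃ σ : ℝ, ∀ s : ℝ, 0 ≤ s → s ≤ ε →
    f (x + s • y) = f x + s * σ

/-- `y` is the directional derivative of `f` at `p` in direction `x`, expressed through the
values of the homogeneous function `f` on the far part of the ray `x + ℝ₊ p`. -/
def IsDirDeriv (f : V → ℝ) (C : Set V) (p x : V) (y : ℝ) : Prop :=
  ∃ A : ℝ, ∀ N : ℝ, A ≤ N → N • p + x ∈ C ∧ f (N • p + x) = N * f p + y

/-- A subset of `C` on which `f` is linear, and which is the sum of the subspace `W` and the cone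
over a family `v` that is linearly independent modulo `W`, with coordinate functionals `c`. -/
def IsSimplicialPiece (W : Submodule ℝ V) (f : V → ℝ) (C D : Set V) : Prop :=
  D ⊆ C ∧ (∃ ℓ : V →ₗ[ℝ] ℝ, ∀ x ∈ D, f x = ℓ x) ∧
    ∃ (ι : Type) (_ : Fintype ι) (v : ι → V) (c : ι → V →ₗ[ℝ] ℝ),
      (∀ i, ∀ w ∈ W, c i w = 0) ∧ (∀ i, c i (v i) = 1) ∧ (∀ i j, i ≠ j → c i (v j) = 0) ∧
      D = {x | (∀ i, 0 ≤ c i x) ∧ x - ∑ i, c i x • v i ∈ W}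

theorem halfspaceCone_zero (Φ : Finset (V →ₗ[ℝ] ℝ)) : (0 : V) ∈ halfspaceCone Φ := by
  intro φ _; simp

theorem halfspaceCone_add {Φ : Finset (V →ₗ[ℝ] ℝ)} {x y : V} (hx : x ∈ halfspaceCone Φ)
    (hy : y ∈ halfspaceCone Φ) : x + y ∈ halfspaceCone Φ := by
  intro φ hφ
  rw [map_add]
  exact add_nonneg (hx φ hφ) (hy φ hφ)

theorem halfspaceCone_smul {Φ : Finset (V →ₗ[ℝ] ℝ)} {x : V} (hx : x ∈ halfspaceCone Φ) {a : ℝ}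
    (ha : 0 ≤ a) : a • x ∈ halfspaceCone Φ := by
  intro φ hφ
  rw [map_smul]
  exact mul_nonneg ha (hx φ hφ)

theorem halfspaceCone_sum {Φ : Finset (V →ₗ[ℝ] ℝ)} {ι : Type*} (s : Finset ι) {v : ι → V}
    (hv : ∀ i, v i ∈ halfspaceCone Φ) {a : ι → ℝ} (ha : ∀ i, 0 ≤ a i) :
    ∑ i ∈ s, a i • v i ∈ halfspaceCone Φ := by
  intro φ hφ
  simp only [map_sum, map_smul, smul_eq_mul]
  exact Finset.sum_nonneg fun i _ => mul_nonneg (ha i) (hv i φ hφ)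

namespace IsRadiallyAffine

variable {f : V → ℝ} {Φ : Finset (V →ₗ[ℝ] ℝ)}

theorem map_zero (hf : IsRadiallyAffine f (halfspaceCone Φ)) : f 0 = 0 := by
  have := hf.map_smul 0 (halfspaceCone_zero Φ) 2 (by norm_num)
  rw [smul_zero] at this
  linarith

theorem map_smul_nonneg (hf : IsRadiallyAffine f (halfspaceCone Φ)) {x : V}
    (hx : x ∈ halfspaceCone Φ) {a : ℝ} (ha : 0 ≤ a) : f (a • x) = a * f x := by
  rcases ha.eq_or_lt with rfl | ha
  · simp [hf.map_zero]
  · exact hf.map_smul x hx a ha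

theorem sum_le (hf : IsRadiallyAffine f (halfspaceCone Φ)) {ι : Type*} (s : Finset ι) {v : ι → V}
    (hv : ∀ i, v i ∈ halfspaceCone Φ) {a : ι → ℝ} (ha : ∀ i, 0 ≤ a i) :
    ∑ i ∈ s, a i * f (v i) ≤ f (∑ i ∈ s, a i • v i) := by
  classical
  induction s using Finset.induction_on with
  | empty => simp [hf.map_zero]
  | insert i s hi ih =>
    rw [Finset.sum_insert hi, Finset.sum_insert hi]
    have := hf.add_le _ (halfspaceCone_smul (hv i) (ha i)) _ (halfspaceCone_sum s hv ha)
    rw [hf.map_smul_nonneg (hv i) (ha i)] at this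
    linarith

theorem map_add_of_map_neg (hf : IsRadiallyAffine f (halfspaceCone Φ)) {x w : V}
    (hx : x ∈ halfspaceCone Φ) (hw : w ∈ halfspaceCone Φ) (hw' : -w ∈ halfspaceCone Φ)
    (h : f w + f (-w) = 0) : f (x + w) = f x + f w := by
  have h1 := hf.add_le x hx w hw
  have h2 := hf.add_le _ (halfspaceCone_add hx hw) _ hw'
  rw [add_neg_cancel_right] at h2
  linarith

theorem exists_isDirDeriv (hf : IsRadiallyAffine f (halfspaceCone Φ)) {p x : V}
    (hp : p ∈ halfspaceCone Φ) (hx : x ∈ halfspaceCone (Φ.filter fun φ => φ p = 0)) :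
    ∃ y, IsDirDeriv f (halfspaceCone Φ) p x y := by
  have key : ∃ A : ℝ, 0 ≤ A ∧ A • p + x ∈ halfspaceCone Φ := by
    refine ⟨∑ φ ∈ Φ, |φ x| / φ p, Finset.sum_nonneg fun φ hφ =>
      div_nonneg (abs_nonneg _) (hp φ hφ), fun φ hφ => ?_⟩
    rw [map_add, _root_.map_smul, smul_eq_mul]
    rcases (hp φ hφ).eq_or_lt with h | h
    · have := hx φ (Finset.mem_filter.2 ⟨hφ, h.symm⟩)
      rw [← h]; linarith
    · have h1 : |φ x| / φ p ≤ ∑ φ ∈ Φ, |φ x| / φ p :=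
        Finset.single_le_sum (f := fun φ : V →ₗ[ℝ] ℝ => |φ x| / φ p)
          (fun φ hφ => div_nonneg (abs_nonneg _) (hp φ hφ)) hφ
      rw [div_le_iff₀ h] at h1
      linarith [neg_abs_le (φ x)]
  obtain ⟨A, hA, hz⟩ := key
  obtain ⟨ε, hε, σ, hσ⟩ := hf.radial p hp _ hz
  refine ⟨σ - A * f p, A + 1 / ε, fun N hN => ?_⟩
  have hpos : 0 < N - A := by linarith [one_div_pos.2 hε]
  have e : N • p + x = (N - A) • (p + (1 / (N - A)) • (A • p + x)) := by
    rw [smul_add, smul_smul, mul_one_div_cancel hpos.ne', one_smul]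
    module
  have hm : p + (1 / (N - A)) • (A • p + x) ∈ halfspaceCone Φ :=
    halfspaceCone_add hp (halfspaceCone_smul hz (by positivity))
  refine ⟨e ▸ halfspaceCone_smul hm hpos.le, ?_⟩
  have hle : 1 / (N - A) ≤ ε := by
    rw [one_div_le hpos hε]; linarith
  rw [e, hf.map_smul _ hm _ hpos, hσ _ (by positivity) hle]
  field_simp
  ring

end IsRadiallyAffine

theorem IsDirDeriv.unique {f : V → ℝ} {C : Set V} {p x : V} {y z : ℝ}
    (hy : IsDirDeriv f C p x y) (hz : IsDirDeriv f C p x z) : y = z := by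
  obtain ⟨A, hA⟩ := hy
  obtain ⟨B, hB⟩ := hz
  have h1 := (hA _ (le_max_left A B)).2
  have h2 := (hB _ (le_max_right A B)).2
  linarith

theorem IsDirDeriv.add_smul {f : V → ℝ} {C : Set V} {p x : V} {y : ℝ}
    (h : IsDirDeriv f C p x y) (a : ℝ) : IsDirDeriv f C p (x + a • p) (y + a * f p) := by
  obtain ⟨A, hA⟩ := h
  refine ⟨A - a, fun N hN => ?_⟩
  have e : N • p + (x + a • p) = (N + a) • p + x := by module
  obtain ⟨h1, h2⟩ := hA (N + a) (by linarith)
  rw [e]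
  exact ⟨h1, by rw [h2]; ring⟩

namespace IsRadiallyAffine

variable {f : V → ℝ} {Φ : Finset (V →ₗ[ℝ] ℝ)}

theorem exists_isDirDeriv_add_smul (hf : IsRadiallyAffine f (halfspaceCone Φ)) {p v w : V}
    (hp : p ∈ halfspaceCone Φ) (hv : v ∈ halfspaceCone Φ) (hw : w ∈ halfspaceCone Φ)
    (hpv : ∀ a : ℝ, 0 ≤ a → f (a • p + v) = a * f p + f v) :
    ∃ ε : ℝ, 0 < ε ∧ ∃ σ : ℝ, ∀ s : ℝ, 0 ≤ s → s ≤ ε →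
      IsDirDeriv f (halfspaceCone Φ) p (v + s • w) (f v + s * σ) := by
  obtain ⟨ε, hε, σ, hσ⟩ := hf.radial _ (halfspaceCone_add hp hv) w hw
  have h1 : f (p + v) = f p + f v := by simpa using hpv 1 zero_le_one
  refine ⟨ε, hε, σ, fun s hs hsε => ⟨1, fun N hN => ?_⟩⟩
  have hN0 : 0 < N := by linarith
  have hvs := halfspaceCone_add hv (halfspaceCone_smul hw hs)
  have hm := halfspaceCone_add (halfspaceCone_smul hp hN0.le) hvs
  refine ⟨hm, le_antisymm ?_ ?_⟩
  · have e : p + v + (s / N) • w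
        = (1 / N) • (N • p + (v + s • w)) + (1 - 1 / N) • v := by
      rw [smul_add, smul_smul, one_div_mul_cancel hN0.ne']
      module
    have hN1 : 0 ≤ 1 - 1 / N := by
      rw [sub_nonneg, div_le_one hN0]; exact hN
    have h2 := hf.add_le _ (halfspaceCone_smul hm (one_div_pos.2 hN0).le) _
      (halfspaceCone_smul hv hN1)
    rw [← e, hσ _ (by positivity) ((div_le_self hs hN).trans hsε), h1,
      hf.map_smul _ hm _ (one_div_pos.2 hN0), hf.map_smul_nonneg hv hN1] at h2
    have h3 : 1 / N * f (N • p + (v + s • w)) ≤ 1 / N * (N * f p + (f v + s * σ)) := by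
      calc _ ≤ f p + f v + s / N * σ - (1 - 1 / N) * f v := by linarith
        _ = _ := by field_simp; ring
    exact le_of_mul_le_mul_left h3 (one_div_pos.2 hN0)
  · have e : N • p + (v + s • w) = (N - 1) • p + (p + v + s • w) := by module
    have hpvs := halfspaceCone_add (halfspaceCone_add hp hv) (halfspaceCone_smul hw hs)
    have h2 := hf.add_le _ (halfspaceCone_smul hp (sub_nonneg.2 hN)) _ hpvs
    rw [← e, hσ s hs hsε, h1, hf.map_smul_nonneg hp (sub_nonneg.2 hN)] at h2
    linarith

theorem dirDeriv (hf : IsRadiallyAffine f (halfspaceCone Φ)) {p : V} (hp : p ∈ halfspaceCone Φ)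
    {g : V → ℝ} (hg : ∀ x ∈ halfspaceCone (Φ.filter fun φ => φ p = 0),
      IsDirDeriv f (halfspaceCone Φ) p x (g x)) :
    IsRadiallyAffine g (halfspaceCone (Φ.filter fun φ => φ p = 0)) where
  add_le x hx y hy := by
    obtain ⟨A, hA⟩ := hg x hx
    obtain ⟨B, hB⟩ := hg y hy
    obtain ⟨E, hE⟩ := hg _ (halfspaceCone_add hx hy)
    set N := max (max A B) (E / 2)
    obtain ⟨a1, a2⟩ := hA N ((le_max_left _ _).trans (le_max_left _ _))
    obtain ⟨b1, b2⟩ := hB N ((le_max_right _ _).trans (le_max_left _ _))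
    have hN : E / 2 ≤ N := le_max_right _ _
    obtain ⟨-, e2⟩ := hE (2 * N) (by linarith)
    have h := hf.add_le _ a1 _ b1
    have e : N • p + x + (N • p + y) = (2 * N) • p + (x + y) := by module
    rw [e, a2, b2, e2] at h
    linarith
  map_smul x hx a ha := by
    obtain ⟨A, hA⟩ := hg x hx
    refine (hg _ (halfspaceCone_smul hx ha.le)).unique ⟨a * A, fun N hN => ?_⟩
    obtain ⟨h1, h2⟩ := hA (N / a) (by rw [le_div_iff₀ ha]; linarith)
    have e : N • p + a • x = a • ((N / a) • p + x) := by
      rw [smul_add, smul_smul, mul_div_cancel₀ _ ha.ne']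
    rw [e]
    refine ⟨halfspaceCone_smul h1 ha.le, ?_⟩
    rw [hf.map_smul _ h1 _ ha, h2]
    field_simp
  radial v hv w hw := by
    obtain ⟨A, hA⟩ := hg v hv
    obtain ⟨B, hB⟩ := hg w hw
    have hfv : f (A • p + v) = A * f p + g v := (hA A le_rfl).2
    obtain ⟨ε, hε, σ, hσ⟩ := hf.exists_isDirDeriv_add_smul hp (hA A le_rfl).1 (hB B le_rfl).1
      (fun a ha => by
        have e : a • p + (A • p + v) = (a + A) • p + v := by module
        rw [e, (hA (a + A) (by linarith)).2, hfv]; ring)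
    refine ⟨ε, hε, σ - B * f p, fun s hs hsε => ?_⟩
    refine (hg _ (halfspaceCone_add hv (halfspaceCone_smul hw hs))).unique ?_
    have h := (hσ s hs hsε).add_smul (-(A + s * B))
    have e1 : A • p + v + s • (B • p + w) + (-(A + s * B)) • p = v + s • w := by module
    have e2 : f (A • p + v) + s * σ + -(A + s * B) * f p = g v + s * (σ - B * f p) := by
      rw [hfv]; ring
    rwa [e1, e2] at h

end IsRadiallyAffine

theorem mem_halfspaceCone_of_eq_zero {Φ : Finset (V →ₗ[ℝ] ℝ)} {w : V}
    (hw : ∀ φ ∈ Φ, φ w = 0) : w ∈ halfspaceCone Φ := fun φ hφ => (hw φ hφ).ge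

theorem IsSimplicialPiece.smul_add_mem {W : Submodule ℝ V} {f : V → ℝ} {C D : Set V}
    (hD : IsSimplicialPiece W f C D) {x w : V} (hx : x ∈ D) {a : ℝ} (ha : 0 ≤ a) (hw : w ∈ W) :
    a • x + w ∈ D := by
  obtain ⟨-, -, ι, _, v, c, hcW, -, -, rfl⟩ := hD
  have hc : ∀ i, c i (a • x + w) = a * c i x := fun i => by simp [hcW i w hw]
  refine ⟨fun i => (hc i).symm ▸ mul_nonneg ha (hx.1 i), ?_⟩
  have e : a • x + w - ∑ i, c i (a • x + w) • v i = a • (x - ∑ i, c i x • v i) + w := by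
    simp only [hc, mul_smul, smul_sub, Finset.smul_sum]
    abel
  rw [e]
  exact W.add_mem (W.smul_mem a hx.2) hw

theorem isSimplicialPiece_lineality {f : V → ℝ} {Φ : Finset (V →ₗ[ℝ] ℝ)} {W : Submodule ℝ V}
    (hf : IsRadiallyAffine f (halfspaceCone Φ)) (hW : ∀ w ∈ W, ∀ φ ∈ Φ, φ w = 0)
    (hfW : ∀ w ∈ W, f w + f (-w) = 0) :
    IsSimplicialPiece W f (halfspaceCone Φ) W := by
  have hWC : ∀ w ∈ W, w ∈ halfspaceCone Φ := fun w hw => mem_halfspaceCone_of_eq_zero (hW w hw)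
  refine ⟨hWC, ?_, Empty, inferInstance, Empty.elim, fun i => i.elim, fun i => i.elim,
    fun i => i.elim, fun i => i.elim, by ext; simp⟩
  let m : W →ₗ[ℝ] ℝ :=
    { toFun := fun w => f w
      map_add' := fun x y => hf.map_add_of_map_neg (hWC _ x.2) (hWC _ y.2)
        (hWC _ (W.neg_mem y.2)) (hfW _ y.2)
      map_smul' := fun a x => by
        change f (a • (x : V)) = a * f x
        rcases le_total 0 a with ha | ha
        · exact hf.map_smul_nonneg (hWC _ x.2) ha
        · have h1 := hf.map_smul_nonneg (hWC _ (W.neg_mem x.2)) (neg_nonneg.2 ha)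
          rw [neg_smul_neg] at h1
          rw [h1]
          linear_combination (-a) * hfW x x.2 }
  obtain ⟨ℓ, hℓ⟩ := LinearMap.exists_extend m
  exact ⟨ℓ, fun x hx => (LinearMap.congr_fun hℓ ⟨x, hx⟩).symm⟩

end RadiallyAffine

section Local

variable {V : Type*} [NormedAddCommGroup V] [NormedSpace ℝ V] [FiniteDimensional ℝ V]

open Topology

theorem IsSimplicialPiece.exists_nhds {f g : V → ℝ} {Φ : Finset (V →ₗ[ℝ] ℝ)}
    {W : Submodule ℝ V} {p : V} {D : Set V}
    (hf : IsRadiallyAffine f (halfspaceCone Φ)) (hW : ∀ w ∈ W, ∀ φ ∈ Φ, φ w = 0)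
    (hfW : ∀ w ∈ W, f w + f (-w) = 0) (hp : p ∈ halfspaceCone Φ) (hpW : p ∉ W)
    (hg : ∀ x ∈ halfspaceCone (Φ.filter fun φ => φ p = 0),
      IsDirDeriv f (halfspaceCone Φ) p x (g x))
    (hD : IsSimplicialPiece (W ⊔ Submodule.span ℝ {p}) g
      (halfspaceCone (Φ.filter fun φ => φ p = 0)) D) :
    ∃ E : Set V, IsSimplicialPiece W f (halfspaceCone Φ) E ∧
      ∃ U ∈ 𝓝 p, ∀ x ∈ U, x ∈ halfspaceCone Φ → x ∈ D → x ∈ E := by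
  classical
  obtain ⟨hDC, ⟨ℓ, hℓ⟩, ι, _, v, c, hcW, hcv, hcv', rfl⟩ := hD
  have hpW' : p ∈ W ⊔ Submodule.span ℝ {p} :=
    Submodule.mem_sup_right (Submodule.mem_span_singleton_self p)
  have hWD : ∀ w ∈ W ⊔ Submodule.span ℝ {p},
      w ∈ {x | (∀ i, 0 ≤ c i x) ∧ x - ∑ i, c i x • v i ∈ W ⊔ Submodule.span ℝ {p}} := by
    intro w hw
    refine ⟨fun i => (hcW i w hw).ge, ?_⟩
    simpa [hcW _ w hw] using hw
  have hvD : ∀ j,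
      v j ∈ {x | (∀ i, 0 ≤ c i x) ∧ x - ∑ i, c i x • v i ∈ W ⊔ Submodule.span ℝ {p}} := by
    intro j
    have hc : ∀ i, c i (v j) = if i = j then 1 else 0 := fun i => by
      split_ifs with h
      · rw [h, hcv]
      · exact hcv' i j h
    refine ⟨fun i => ?_, ?_⟩
    · rw [hc]; split_ifs <;> simp
    · simp [hc]
  have hWC : ∀ w ∈ W, w ∈ halfspaceCone Φ := fun w hw => mem_halfspaceCone_of_eq_zero (hW w hw)
  have hCC' : halfspaceCone Φ ⊆ halfspaceCone (Φ.filter fun φ => φ p = 0) :=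
    fun x hx φ hφ => hx φ (Finset.mem_of_mem_filter φ hφ)
  have hfg : ∀ x ∈ halfspaceCone Φ, f x ≤ g x := by
    intro x hx
    obtain ⟨A, hA⟩ := hg x (hCC' hx)
    have h1 := (hA (max A 0) (le_max_left _ _)).2
    have h2 := hf.add_le _ (halfspaceCone_smul hp (le_max_right A 0)) x hx
    rw [hf.map_smul_nonneg hp (le_max_right A 0)] at h2
    linarith
  have hgW : ∀ w ∈ W, g w = f w := by
    intro w hw
    refine (hg w (hCC' (hWC w hw))).unique ⟨0, fun N hN => ?_⟩
    have hNp := halfspaceCone_smul hp hN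
    refine ⟨halfspaceCone_add hNp (hWC w hw), ?_⟩
    rw [hf.map_add_of_map_neg hNp (hWC w hw) (hWC _ (W.neg_mem hw)) (hfW w hw),
      hf.map_smul_nonneg hp hN]
  have hgp : g p = f p := by
    refine (hg p (hCC' hp)).unique ⟨0, fun N hN => ?_⟩
    have e : N • p + p = (N + 1) • p := by module
    rw [e]
    exact ⟨halfspaceCone_smul hp (by linarith),
      by rw [hf.map_smul_nonneg hp (by linarith)]; ring⟩
  have hu : ∀ i, ∃ N : ℝ, N • p + v i ∈ halfspaceCone Φ ∧
      f (N • p + v i) = N * f p + g (v i) := fun i => by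
    obtain ⟨A, hA⟩ := hg _ (hDC (hvD i))
    exact ⟨A, hA A le_rfl⟩
  choose N huC hfu using hu
  obtain ⟨α, hαp, hαW⟩ : ∃ α : V →ₗ[ℝ] ℝ, α p = 1 ∧ ∀ w ∈ W, α w = 0 := by
    obtain ⟨α, hα, hαW⟩ := W.exists_dual_map_eq_bot_of_notMem hpW inferInstance
    refine ⟨(α p)⁻¹ • α, by simp [hα], fun w hw => ?_⟩
    have : α w ∈ W.map α := Submodule.mem_map_of_mem hw
    rw [hαW, Submodule.mem_bot] at this
    simp [this]
  set u : Option ι → V := fun o => o.elim p fun i => N i • p + v i with hu_def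
  set lam : V →ₗ[ℝ] ℝ := α - ∑ i, α (N i • p + v i) • c i with hlam
  set d : Option ι → V →ₗ[ℝ] ℝ := fun o => o.elim lam c with hd_def
  have hlam_apply : ∀ x, lam x = α x - ∑ i, α (N i • p + v i) * c i x := fun x => by
    simp [hlam, LinearMap.sum_apply]
  have hcp : ∀ i, c i p = 0 := fun i => hcW i p hpW'
  have hlamp : lam p = 1 := by simp [hlam_apply, hcp, hαp]
  have huC' : ∀ o, u o ∈ halfspaceCone Φ := by
    rintro (_ | i)
    · exact hp
    · exact huC i
  have hfuℓ : ∀ o, f (u o) = ℓ (u o) := by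
    have hpℓ : f p = ℓ p := by rw [← hgp]; exact hℓ p (hWD p hpW')
    rintro (_ | i)
    · exact hpℓ
    · change f (N i • p + v i) = ℓ (N i • p + v i)
      rw [hfu, map_add, map_smul, smul_eq_mul, hpℓ, hℓ _ (hvD i)]
  have hsum : ∀ x, x - ∑ o, d o x • u o
      = x - ∑ i, c i x • v i - (lam x + ∑ i, c i x * N i) • p := by
    intro x
    rw [Fintype.sum_option]
    simp only [hd_def, hu_def, Option.elim, smul_add, Finset.sum_add_distrib, add_smul,
      Finset.sum_smul, smul_smul]
    abel
  refine ⟨{x | (∀ o, 0 ≤ d o x) ∧ x - ∑ o, d o x • u o ∈ W}, ⟨?_, ⟨ℓ, ?_⟩, ?_⟩,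
    {x | 0 < lam x}, ?_, ?_⟩
  · rintro x ⟨hx, hxW⟩
    have := halfspaceCone_add (hWC _ hxW) (halfspaceCone_sum Finset.univ huC' hx)
    rwa [sub_add_cancel] at this
  · rintro x ⟨hx, hxW⟩
    have hsC := halfspaceCone_sum Finset.univ huC' hx
    have hxC := halfspaceCone_add (hWC _ hxW) hsC
    rw [sub_add_cancel] at hxC
    apply le_antisymm
    · refine (hfg x hxC).trans (hℓ x ⟨fun i => hx (some i), ?_⟩).le
      have h1 := hsum x
      have h2 : x - ∑ i, c i x • v i
          = (x - ∑ o, d o x • u o) + (lam x + ∑ i, c i x * N i) • p := by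
        rw [h1, sub_add_cancel]
      rw [h2]
      exact Submodule.add_mem _ (Submodule.mem_sup_left hxW) (Submodule.smul_mem _ _ hpW')
    · have h1 := hf.add_le _ (hWC _ hxW) _ hsC
      have h2 := hf.sum_le Finset.univ huC' hx
      rw [sub_add_cancel] at h1
      have h3 : f (x - ∑ o, d o x • u o) = ℓ (x - ∑ o, d o x • u o) := by
        rw [← hgW _ hxW]; exact hℓ _ (hWD _ (Submodule.mem_sup_left hxW))
      have h4 : ℓ x = ℓ (x - ∑ o, d o x • u o) + ∑ o, d o x * f (u o) := by
        simp only [hfuℓ, map_sub, map_sum, map_smul, smul_eq_mul]; ring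
      linarith
  · refine ⟨Option ι, inferInstance, u, d, ?_, ?_, ?_, rfl⟩
    · rintro (_ | i) w hw
      · change lam w = 0
        simp [hlam_apply, hαW w hw, hcW _ w (Submodule.mem_sup_left hw)]
      · exact hcW i w (Submodule.mem_sup_left hw)
    · rintro (_ | i)
      · exact hlamp
      · change c i (N i • p + v i) = 1
        simp [hcp, hcv]
    · rintro (_ | i) (_ | j) hij
      · exact absurd rfl hij
      · change lam (N j • p + v j) = 0
        rw [hlam_apply, Finset.sum_eq_single j]
        · simp [hcp, hcv]
        · intro i _ h; simp [hcp, hcv' i j h]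
        · simp
      · exact hcp i
      · change c i (N j • p + v j) = 0
        simp [hcp, hcv' i j fun h => hij (congrArg some h)]
  · refine (isOpen_lt continuous_const lam.continuous_of_finiteDimensional).mem_nhds ?_
    change 0 < lam p
    rw [hlamp]; exact one_pos
  · rintro x hx - ⟨hxc, hxW⟩
    refine ⟨?_, ?_⟩
    · rintro (_ | i)
      · exact le_of_lt hx
      · exact hxc i
    · obtain ⟨w, hw, q, hq, hwq⟩ := Submodule.mem_sup.1 hxW
      obtain ⟨a, rfl⟩ := Submodule.mem_span_singleton.1 hq
      have hxe : x = w + a • p + ∑ i, c i x • v i := by rw [hwq]; abel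
      have hlx : lam x + ∑ i, c i x * N i = a := by
        have h1 : α x = a + ∑ i, c i x * α (v i) := by
          conv_lhs => rw [hxe]
          simp [hαW w hw, hαp]
        rw [hlam_apply, h1]
        simp only [map_add, map_smul, hαp, smul_eq_mul, mul_one, add_mul, Finset.sum_add_distrib]
        simp only [mul_comm (c _ x)]
        ring
      rw [hsum, hlx, ← hwq, add_sub_cancel_right]
      exact hw

theorem isClosed_halfspaceCone (Φ : Finset (V →ₗ[ℝ] ℝ)) : IsClosed (halfspaceCone Φ) := by
  have : halfspaceCone Φ = ⋂ φ ∈ Φ, {x : V | 0 ≤ φ x} := by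
    ext x; simp [halfspaceCone]
  rw [this]
  exact isClosed_biInter fun φ _ =>
    isClosed_le continuous_const φ.continuous_of_finiteDimensional

theorem IsRadiallyAffine.exists_finite_cover (n : ℕ) :
    ∀ (f : V → ℝ) (Φ : Finset (V →ₗ[ℝ] ℝ)) (W : Submodule ℝ V),
      IsRadiallyAffine f (halfspaceCone Φ) → (∀ w ∈ W, ∀ φ ∈ Φ, φ w = 0) →
      (∀ w ∈ W, f w + f (-w) = 0) → Module.finrank ℝ V ≤ Module.finrank ℝ W + n →
      ∃ S : Set (Set V), S.Finite ∧ (∀ D ∈ S, IsSimplicialPiece W f (halfspaceCone Φ) D) ∧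
        halfspaceCone Φ ⊆ ⋃₀ S := by
  classical
  induction n with
  | zero =>
    intro f Φ W hf hW hfW hn
    have hWtop : W = ⊤ := Submodule.eq_top_of_finrank_eq (le_antisymm W.finrank_le hn)
    refine ⟨{(W : Set V)}, Set.finite_singleton _, ?_, ?_⟩
    · rintro D rfl
      exact isSimplicialPiece_lineality hf hW hfW
    · simp [hWtop]
  | succ n ih =>
    intro f Φ W hf hW hfW hn
    have hWC : ∀ w ∈ W, w ∈ halfspaceCone Φ := fun w hw => mem_halfspaceCone_of_eq_zero (hW w hw)
    have hloc : ∀ p ∈ halfspaceCone Φ, p ∉ W → ∃ U ∈ 𝓝 p, ∃ S : Set (Set V), S.Finite ∧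
        (∀ D ∈ S, IsSimplicialPiece W f (halfspaceCone Φ) D) ∧
        U ∩ halfspaceCone Φ ⊆ ⋃₀ S := by
      intro p hp hpW
      have hex : ∀ x, ∃ y, x ∈ halfspaceCone (Φ.filter fun φ => φ p = 0) →
          IsDirDeriv f (halfspaceCone Φ) p x y := fun x => by
        by_cases hx : x ∈ halfspaceCone (Φ.filter fun φ => φ p = 0)
        · obtain ⟨y, hy⟩ := hf.exists_isDirDeriv hp hx
          exact ⟨y, fun _ => hy⟩
        · exact ⟨0, fun h => absurd h hx⟩
      choose g hg using hex
      have hW' : ∀ w ∈ W ⊔ Submodule.span ℝ {p}, ∀ φ ∈ Φ.filter (fun φ => φ p = 0), φ w = 0 := by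
        intro x hx φ hφ
        rw [Finset.mem_filter] at hφ
        obtain ⟨w, hw, q, hq, rfl⟩ := Submodule.mem_sup.1 hx
        obtain ⟨a, rfl⟩ := Submodule.mem_span_singleton.1 hq
        simp [hW w hw φ hφ.1, hφ.2]
      have hgW' : ∀ w ∈ W ⊔ Submodule.span ℝ {p}, g w + g (-w) = 0 := by
        have hval : ∀ w ∈ W, ∀ a : ℝ, g (w + a • p) = f w + a * f p := by
          intro w hw a
          have hmem : w + a • p ∈ W ⊔ Submodule.span ℝ {p} :=
            Submodule.add_mem_sup hw (Submodule.smul_mem _ _ (Submodule.mem_span_singleton_self p))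
          refine (hg _ (mem_halfspaceCone_of_eq_zero (hW' _ hmem))).unique
            (IsDirDeriv.add_smul ⟨0, fun N hN => ?_⟩ a)
          have hNp := halfspaceCone_smul hp hN
          refine ⟨halfspaceCone_add hNp (hWC w hw), ?_⟩
          rw [hf.map_add_of_map_neg hNp (hWC w hw) (hWC _ (W.neg_mem hw)) (hfW w hw),
            hf.map_smul_nonneg hp hN]
        intro x hx
        obtain ⟨w, hw, q, hq, rfl⟩ := Submodule.mem_sup.1 hx
        obtain ⟨a, rfl⟩ := Submodule.mem_span_singleton.1 hq
        have e : -(w + a • p) = -w + (-a) • p := by module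
        rw [e, hval w hw, hval _ (W.neg_mem hw)]
        linear_combination hfW w hw
      have hlt : Module.finrank ℝ W < Module.finrank ℝ ↥(W ⊔ Submodule.span ℝ {p}) := by
        apply Submodule.finrank_lt_finrank_of_lt
        refine lt_of_le_of_ne le_sup_left fun h => hpW ?_
        rw [h]
        exact Submodule.mem_sup_right (Submodule.mem_span_singleton_self p)
      obtain ⟨S, hSfin, hS, hcov⟩ := ih g _ _ (hf.dirDeriv hp hg) hW' hgW' (by omega)
      have hpiece := fun D (hD : D ∈ S) => (hS D hD).exists_nhds hf hW hfW hp hpW hg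
      choose! E hE U hU hUE using hpiece
      refine ⟨⋂ D ∈ S, U D, (Filter.biInter_mem hSfin).2 hU, E '' S, hSfin.image E, ?_, ?_⟩
      · rintro _ ⟨D, hD, rfl⟩
        exact hE D hD
      · rintro x ⟨hxU, hxC⟩
        obtain ⟨D, hD, hxD⟩ := hcov fun φ hφ => hxC φ (Finset.mem_of_mem_filter φ hφ)
        exact ⟨E D, ⟨D, hD, rfl⟩, hUE D hD x (Set.mem_iInter₂.1 hxU D hD) hxC hxD⟩
    obtain ⟨W₂, hW₂⟩ := W.exists_isCompl
    have hK : IsCompact (Metric.sphere (0 : V) 1 ∩ (halfspaceCone Φ ∩ W₂)) :=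
      (isCompact_sphere 0 1).inter_right
        ((isClosed_halfspaceCone Φ).inter W₂.closed_of_finiteDimensional)
    obtain ⟨S, hSfin, hS, hcov⟩ : ∃ S : Set (Set V), S.Finite ∧
        (∀ D ∈ S, IsSimplicialPiece W f (halfspaceCone Φ) D) ∧
        (Metric.sphere (0 : V) 1 ∩ (halfspaceCone Φ ∩ W₂)) ∩ halfspaceCone Φ ⊆ ⋃₀ S := by
      refine hK.induction_on (p := fun s => ∃ S : Set (Set V), S.Finite ∧
        (∀ D ∈ S, IsSimplicialPiece W f (halfspaceCone Φ) D) ∧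
        s ∩ halfspaceCone Φ ⊆ ⋃₀ S) ?_ ?_ ?_ ?_
      · exact ⟨∅, Set.finite_empty, by simp, by simp⟩
      · rintro s t hst ⟨S, h1, h2, h3⟩
        exact ⟨S, h1, h2, (Set.inter_subset_inter_left _ hst).trans h3⟩
      · rintro s t ⟨S, h1, h2, h3⟩ ⟨T, h4, h5, h6⟩
        refine ⟨S ∪ T, h1.union h4, ?_, ?_⟩
        · rintro D (hD | hD)
          exacts [h2 D hD, h5 D hD]
        · rw [Set.union_inter_distrib_right, Set.sUnion_union]
          exact Set.union_subset_union h3 h6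
      · rintro p ⟨hp1, hpC, hpW₂⟩
        have hpW : p ∉ W := fun h => by
          have : p = 0 := Submodule.disjoint_def.1 hW₂.disjoint p h hpW₂
          simp [this] at hp1
        obtain ⟨U, hU, S, h⟩ := hloc p hpC hpW
        exact ⟨U, mem_nhdsWithin_of_mem_nhds hU, S, h⟩
    refine ⟨insert (W : Set V) S, hSfin.insert _, ?_, ?_⟩
    · rintro D (rfl | hD)
      exacts [isSimplicialPiece_lineality hf hW hfW, hS D hD]
    · intro x hx
      have hxtop : x ∈ W ⊔ W₂ := by rw [hW₂.sup_eq_top]; trivial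
      obtain ⟨w, hw, z, hz, rfl⟩ := Submodule.mem_sup.1 hxtop
      rcases eq_or_ne z 0 with rfl | hz0
      · exact ⟨W, Set.mem_insert _ _, by simpa using hw⟩
      · have hzC : z ∈ halfspaceCone Φ := by
          have := halfspaceCone_add hx (hWC _ (W.neg_mem hw))
          rwa [add_neg_cancel_comm] at this
        have hz' : ‖z‖ ≠ 0 := norm_ne_zero_iff.2 hz0
        have hyC : ‖z‖⁻¹ • z ∈ halfspaceCone Φ := halfspaceCone_smul hzC (by positivity)
        obtain ⟨D, hD, hyD⟩ := hcov ⟨⟨by simp [norm_smul, hz'], hyC, W₂.smul_mem _ hz⟩, hyC⟩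
        refine ⟨D, Set.mem_insert_of_mem _ hD, ?_⟩
        have := (hS D hD).smul_add_mem hyD (norm_nonneg z) hw
        rwa [smul_smul, mul_inv_cancel₀ hz', one_smul, add_comm] at this

end Local

theorem exists_linearIndepOn_conic_combination {ι V : Type*} [AddCommGroup V] [Module ℝ V]
    (v : ι → V) (n : ℕ) :
    ∀ (s : Finset ι) (c : ι → ℝ), s.card ≤ n → (∀ i ∈ s, 0 ≤ c i) →
      ∃ (t : Finset ι) (d : ι → ℝ), LinearIndepOn ℝ v (t : Set ι) ∧ (∀ i ∈ t, 0 ≤ d i) ∧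
        ∑ i ∈ t, d i • v i = ∑ i ∈ s, c i • v i := by
  classical
  induction n with
  | zero =>
    intro s c hs hc
    obtain rfl : s = ∅ := Finset.card_eq_zero.1 (Nat.le_zero.1 hs)
    exact ⟨∅, c, by simp [linearIndepOn_empty], hc, rfl⟩
  | succ n ih =>
    intro s c hs hc
    by_cases hli : LinearIndepOn ℝ v (s : Set ι)
    · exact ⟨s, c, hli, hc, rfl⟩
    obtain ⟨g, hg0, i, hi, hgi⟩ :
        ∃ g : ι → ℝ, ∑ i ∈ s, g i • v i = 0 ∧ ∃ i ∈ s, 0 < g i := by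
      rw [linearIndepOn_finset_iff] at hli
      push Not at hli
      obtain ⟨g, hg0, i, hi, hgi⟩ := hli
      rcases hgi.lt_or_gt with h | h
      · exact ⟨fun j => -g j, by simp [hg0], i, hi, by simpa using h⟩
      · exact ⟨g, hg0, i, hi, h⟩
    obtain ⟨j, hj, hmin⟩ := Finset.exists_min_image (s.filter fun i => 0 < g i)
      (fun i => c i / g i) ⟨i, Finset.mem_filter.2 ⟨hi, hgi⟩⟩
    obtain ⟨hjs, hgj⟩ := Finset.mem_filter.1 hj
    obtain ⟨t, d, ht, hd, hsum⟩ := ih (s.erase j) (fun i => c i - c j / g j * g i)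
      (by rw [Finset.card_erase_of_mem hjs]; omega) (fun i hi => by
        have his := Finset.mem_of_mem_erase hi
        rcases le_or_gt (g i) 0 with h | h
        · have := mul_nonpos_of_nonneg_of_nonpos (div_nonneg (hc j hjs) hgj.le) h
          linarith [hc i his]
        · have := hmin i (Finset.mem_filter.2 ⟨his, h⟩)
          rw [le_div_iff₀ h] at this
          linarith)
    refine ⟨t, d, ht, hd, hsum.trans ?_⟩
    have hzero : (c j - c j / g j * g j) • v j = 0 := by
      rw [div_mul_cancel₀ _ hgj.ne', sub_self, zero_smul]
    rw [Finset.sum_erase s (f := fun i => (c i - c j / g j * g i) • v i) hzero]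
    simp only [sub_smul, mul_smul, Finset.sum_sub_distrib, ← Finset.smul_sum, hg0, smul_zero,
      sub_zero]

namespace IsPolyhedralCone

variable {n : ℕ} {C : Set (Fin n → ℝ)}

protected theorem isClosed (hC : IsPolyhedralCone C) : IsClosed C := by
  classical
  obtain ⟨k, v, rfl⟩ := hC
  have h : {x | ∃ c : Fin k → ℝ, (∀ i, 0 ≤ c i) ∧ x = ∑ i, c i • v i}
      = ⋃ t ∈ {t : Finset (Fin k) | LinearIndepOn ℝ v (t : Set (Fin k))},
        Fintype.linearCombination ℝ (fun i : t => v i) '' {c | ∀ i, 0 ≤ c i} := by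
    ext x
    simp only [Set.mem_ofPred_eq, Set.mem_iUnion, Set.mem_image, exists_prop,
      Fintype.linearCombination_apply]
    constructor
    · rintro ⟨c, hc, rfl⟩
      obtain ⟨t, d, ht, hd, hsum⟩ := exists_linearIndepOn_conic_combination v _
        Finset.univ c le_rfl fun i _ => hc i
      refine ⟨t, ht, fun i => d i, fun i => hd i i.2, ?_⟩
      rw [← hsum, ← Finset.sum_coe_sort t]
    · rintro ⟨t, -, c, hc, rfl⟩
      refine ⟨fun i => if h : i ∈ t then c ⟨i, h⟩ else 0, fun i => ?_, ?_⟩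
      · dsimp only
        split_ifs
        exacts [hc _, le_rfl]
      · rw [← Finset.sum_subset (Finset.subset_univ t) (fun i _ hi => by simp [hi]),
          ← Finset.sum_coe_sort t]
        simp
  rw [h]
  refine (Set.toFinite _).isClosed_biUnion fun t ht => ?_
  have hinj : LinearMap.ker (Fintype.linearCombination ℝ (fun i : t => v i)) = ⊥ :=
    LinearMap.ker_eq_bot.2 (linearIndependent_iff_injective_fintypeLinearCombination.1 ht)
  refine (LinearMap.isClosedEmbedding_of_injective hinj).isClosedMap _ ?_
  simp only [Set.ofPred_forall]
  exact isClosed_iInter fun i => isClosed_le continuous_const (continuous_apply i)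

theorem smul_add_smul_mem (hC : IsPolyhedralCone C) {x y : Fin n → ℝ} (hx : x ∈ C) (hy : y ∈ C)
    {a b : ℝ} (ha : 0 ≤ a) (hb : 0 ≤ b) : a • x + b • y ∈ C := by
  obtain ⟨k, v, rfl⟩ := hC
  obtain ⟨c, hc, rfl⟩ := hx
  obtain ⟨d, hd, rfl⟩ := hy
  refine ⟨fun i => a * c i + b * d i, fun i =>
    add_nonneg (mul_nonneg ha (hc i)) (mul_nonneg hb (hd i)), ?_⟩
  simp only [add_smul, mul_smul, Finset.sum_add_distrib, Finset.smul_sum]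

end IsPolyhedralCone

open Filter Topology in
theorem IsPiecewiseLinearOn.exists_radial {n : ℕ} {f : (Fin n → ℝ) → ℝ} {C : Set (Fin n → ℝ)}
    (hf : IsPiecewiseLinearOn f C) {x y : Fin n → ℝ}
    (hxy : ∀ s : ℝ, 0 ≤ s → x + s • y ∈ C) :
    ∃ ε : ℝ, 0 < ε ∧ ∃ σ : ℝ, ∀ s : ℝ, 0 ≤ s → s ≤ ε → f (x + s • y) = f x + s * σ := by
  obtain ⟨m, D, hD, rfl, hℓ⟩ := hf
  have hmem : ∀ k : ℕ, ∃ i, x + (1 / ((k : ℝ) + 1)) • y ∈ D i := fun k =>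
    Set.mem_iUnion.1 (hxy _ (by positivity))
  choose i hi using hmem
  obtain ⟨j, hj⟩ := Finite.exists_infinite_fiber i
  have hfreq : ∃ᶠ k in atTop, i k = j :=
    Nat.frequently_atTop_iff_infinite.2 (Set.infinite_coe_iff.1 hj)
  have hlim : Tendsto (fun k : ℕ => x + (1 / ((k : ℝ) + 1)) • y) atTop (𝓝 x) := by
    have := (tendsto_one_div_add_atTop_nhds_zero_nat (𝕜 := ℝ)).smul_const y
    simpa using this.const_add x
  have hxD : x ∈ D j :=
    (hD j).isClosed.mem_of_frequently_of_tendsto (hfreq.mono fun k hk => hk ▸ hi k) hlim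
  obtain ⟨k, rfl⟩ := hfreq.exists
  obtain ⟨ℓ, hℓ⟩ := hℓ (i k)
  have hk : (0 : ℝ) < k + 1 := by positivity
  refine ⟨1 / ((k : ℝ) + 1), by positivity, ℓ y, fun s hs hsk => ?_⟩
  have e : x + s • y
      = (1 - s * (k + 1)) • x + (s * (k + 1)) • (x + (1 / ((k : ℝ) + 1)) • y) := by
    rw [smul_add, smul_smul, mul_assoc, mul_one_div_cancel hk.ne']
    module
  have hs1 : 0 ≤ 1 - s * (k + 1) := by
    rw [le_div_iff₀ hk] at hsk
    linarith
  have hmem := (hD (i k)).smul_add_smul_mem hxD (hi k) hs1 (mul_nonneg hs hk.le)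
  rw [← e] at hmem
  rw [hℓ _ hmem, hℓ _ hxD, map_add, map_smul, smul_eq_mul]

/-- A function that is linear on a simplicial piece and factors through a linear
map `A` yields a linear function on the image of the piece, which is a polyhedral cone. -/
theorem IsSimplicialPiece.image_linearMap {U : Type*} [AddCommGroup U] [Module ℝ U] {n : ℕ}
    {f : (Fin n → ℝ) → ℝ} {A : U →ₗ[ℝ] Fin n → ℝ} {C D : Set U}
    (hD : IsSimplicialPiece ⊥ (fun x => f (A x)) C D) :
    IsPolyhedralCone (A '' D) ∧ ∃ ℓ : (Fin n → ℝ) →ₗ[ℝ] ℝ, ∀ x ∈ A '' D, f x = ℓ x := by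
  classical
  obtain ⟨-, ⟨ℓ, hℓ⟩, ι, _, v, c, -, hcv, hcv', rfl⟩ := hD
  have hc : ∀ (a : ι → ℝ) i, c i (∑ j, a j • v j) = a i := fun a i => by
    rw [map_sum, Finset.sum_eq_single i]
    · simp [hcv]
    · intro j _ h
      simp [hcv' i j h.symm]
    · simp
  have hmem : ∀ a : ι → ℝ, (∀ i, 0 ≤ a i) →
      ∑ j, a j • v j ∈ {x | (∀ i, 0 ≤ c i x) ∧ x - ∑ i, c i x • v i ∈ (⊥ : Submodule ℝ U)} :=
    fun a ha => ⟨fun i => (hc a i).symm ▸ ha i, by simp [hc]⟩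
  have heq : A '' {x | (∀ i, 0 ≤ c i x) ∧ x - ∑ i, c i x • v i ∈ (⊥ : Submodule ℝ U)}
      = {x | ∃ a : ι → ℝ, (∀ i, 0 ≤ a i) ∧ x = ∑ i, a i • A (v i)} := by
    ext x
    constructor
    · rintro ⟨z, ⟨hz, hz'⟩, rfl⟩
      refine ⟨fun i => c i z, hz, ?_⟩
      rw [Submodule.mem_bot, sub_eq_zero] at hz'
      conv_lhs => rw [hz']
      simp
    · rintro ⟨a, ha, rfl⟩
      exact ⟨_, hmem a ha, by simp⟩
  refine ⟨⟨Fintype.card ι, fun i => A (v ((Fintype.equivFin ι).symm i)), ?_⟩, ?_⟩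
  · rw [heq]
    ext x
    constructor
    · rintro ⟨a, ha, rfl⟩
      exact ⟨fun i => a ((Fintype.equivFin ι).symm i), fun i => ha _,
        ((Fintype.equivFin ι).symm.sum_comp fun i => a i • A (v i)).symm⟩
    · rintro ⟨a, ha, rfl⟩
      refine ⟨fun i => a (Fintype.equivFin ι i), fun i => ha _, ?_⟩
      rw [← (Fintype.equivFin ι).symm.sum_comp]
      simp
  · set B : (ι → ℝ) →ₗ[ℝ] Fin n → ℝ := A ∘ₗ Fintype.linearCombination ℝ v with hB
    set M : (ι → ℝ) →ₗ[ℝ] ℝ := ℓ ∘ₗ Fintype.linearCombination ℝ v with hM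
    have hBM : ∀ a, (∀ i, 0 ≤ a i) → f (B a) = M a := fun a ha => by
      simpa [hB, hM, Fintype.linearCombination_apply] using hℓ _ (hmem a ha)
    have hker : M ∈ (LinearMap.ker B).dualAnnihilator := by
      rw [Submodule.mem_dualAnnihilator]
      intro a ha
      have e : a = (fun i => max (a i) 0) - fun i => max (-a i) 0 := by
        funext i
        exact (max_zero_sub_max_neg_zero_eq_self (a i)).symm
      rw [LinearMap.mem_ker, e, map_sub, sub_eq_zero] at ha
      rw [e, map_sub, ← hBM _ fun i => le_max_right _ _, ← hBM _ fun i => le_max_right _ _, ha,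
        sub_self]
    rw [← LinearMap.range_dualMap_eq_dualAnnihilator_ker] at hker
    obtain ⟨ℓ', hℓ'⟩ := hker
    refine ⟨ℓ', ?_⟩
    rw [heq]
    rintro x ⟨a, ha, rfl⟩
    have e : ∑ i, a i • A (v i) = B a := by simp [hB, Fintype.linearCombination_apply]
    rw [e, hBM a ha, ← hℓ', LinearMap.dualMap_apply]

/-- **Piecewise linearity can be tested on 2-planes.** Let `C ⊆ ℝ^{r+1}` be a polyhedral
cone of full dimension `r+1` and let `f : C → ℝ` be superlinear, such that for every
2-dimensional linear subspace `H ⊆ ℝ^{r+1}` the restriction of `f` to `H ∩ C` is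
piecewise linear. Then `f` is piecewise linear on `C`. -/
theorem piecewiseLinear_of_piecewiseLinear_on_two_planes
    (r : ℕ) (C : Set (Fin (r + 1) → ℝ)) (hC : IsPolyhedralCone C)
    (hdim : (interior C).Nonempty)
    (f : (Fin (r + 1) → ℝ) → ℝ)
    (hsuper : ∀ x ∈ C, ∀ y ∈ C, ∀ a b : ℝ, 0 ≤ a → 0 ≤ b →
      a * f x + b * f y ≤ f (a • x + b • y))
    (hH : ∀ H : Submodule ℝ (Fin (r + 1) → ℝ), Module.finrank ℝ H = 2 →
      IsPiecewiseLinearOn f ((H : Set (Fin (r + 1) → ℝ)) ∩ C)) :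
    IsPiecewiseLinearOn f C := by
  classical
  have hmulsmul : ∀ x ∈ C, ∀ a : ℝ, 0 < a → f (a • x) = a * f x := by
    intro x hx a ha
    have hax : a • x ∈ C := by
      simpa using hC.smul_add_smul_mem hx hx ha.le le_rfl
    have h1 := hsuper x hx x hx a 0 ha.le le_rfl
    have h2 := hsuper _ hax _ hax a⁻¹ 0 (by positivity) le_rfl
    simp only [zero_mul, add_zero, zero_smul, smul_smul, inv_mul_cancel₀ ha.ne', one_smul] at h1 h2
    refine le_antisymm ?_ h1
    have := mul_le_mul_of_nonneg_left h2 ha.le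
    rwa [mul_inv_cancel_left₀ ha.ne'] at this
  have hradial : ∀ x ∈ C, ∀ y ∈ C, ∃ ε : ℝ, 0 < ε ∧ ∃ σ : ℝ, ∀ s : ℝ, 0 ≤ s → s ≤ ε →
      f (x + s • y) = f x + s * σ := by
    intro x hx y hy
    rcases eq_or_ne x 0 with rfl | hx0
    · have h0 : f 0 = 0 := by
        have := hmulsmul 0 hx 2 two_pos
        rw [smul_zero] at this
        linarith
      refine ⟨1, one_pos, f y, fun s hs _ => ?_⟩
      rcases hs.eq_or_lt with rfl | hs
      · simp
      · rw [zero_add, h0, zero_add, hmulsmul y hy s hs]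
    by_cases hli : ∃ a : ℝ, a • x = y
    · obtain ⟨a, rfl⟩ := hli
      refine ⟨1 / (1 + |a|), by positivity, a * f x, fun s hs hsa => ?_⟩
      have hpos : 0 < 1 + s * a := by
        rw [le_div_iff₀ (by positivity)] at hsa
        rcases hs.eq_or_lt with rfl | hs
        · simp
        · nlinarith [mul_le_mul_of_nonneg_left (neg_abs_le a) hs.le]
      have e : x + s • a • x = (1 + s * a) • x := by module
      rw [e, hmulsmul x hx _ hpos]
      ring
    · push Not at hli
      have hind : LinearIndependent ℝ ![x, y] := (LinearIndependent.pair_iff' hx0).2 hli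
      refine (hH (Submodule.span ℝ (Set.range ![x, y])) ?_).exists_radial fun s hs => ⟨?_, ?_⟩
      · simpa using finrank_span_eq_card hind
      · exact Submodule.add_mem _ (Submodule.subset_span ⟨0, rfl⟩)
          (Submodule.smul_mem _ _ (Submodule.subset_span ⟨1, rfl⟩))
      · simpa using hC.smul_add_smul_mem hx hy zero_le_one hs
  obtain ⟨k, v, hCv⟩ := id hC
  set A : (Fin k → ℝ) →ₗ[ℝ] Fin (r + 1) → ℝ := Fintype.linearCombination ℝ v with hA
  set Φ : Finset ((Fin k → ℝ) →ₗ[ℝ] ℝ) := Finset.univ.image LinearMap.proj with hΦ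
  have hmem : ∀ c, c ∈ halfspaceCone Φ ↔ ∀ i, 0 ≤ c i := fun c => by
    simp [halfspaceCone, hΦ]
  have hAC : A '' halfspaceCone Φ = C := by
    rw [hCv]
    ext x
    simp [hmem, hA, Fintype.linearCombination_apply, eq_comm]
  have hA' : ∀ c ∈ halfspaceCone Φ, A c ∈ C := fun c hc => hAC ▸ Set.mem_image_of_mem A hc
  have hF : IsRadiallyAffine (fun c => f (A c)) (halfspaceCone Φ) :=
    { add_le := fun x hx y hy => by
        simpa using hsuper _ (hA' x hx) _ (hA' y hy) 1 1 zero_le_one zero_le_one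
      map_smul := fun x hx a ha => by
        simpa using hmulsmul _ (hA' x hx) a ha
      radial := fun x hx y hy => by
        simpa using hradial _ (hA' x hx) _ (hA' y hy) }
  have h0 : f (A 0) = 0 := hF.map_zero
  obtain ⟨S, hSfin, hS, hcov⟩ := IsRadiallyAffine.exists_finite_cover
    (Module.finrank ℝ (Fin k → ℝ)) _ Φ ⊥ hF (by simp) (by simpa using h0) (by simp)
  obtain ⟨m, D, -, hD⟩ := hSfin.fin_param
  have hDS : ∀ i, D i ∈ S := fun i => hD ▸ Set.mem_range_self i
  refine ⟨m, fun i => A '' D i, fun i => (hS _ (hDS i)).image_linearMap.1, ?_,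
    fun i => (hS _ (hDS i)).image_linearMap.2⟩
  rw [← Set.image_iUnion, ← Set.sUnion_range, hD, ← hAC]
  congr 1
  exact hcov.antisymm (Set.sUnion_subset fun E hE => (hS E hE).1)
end

section
/- Let S ⊆ ℕ^r be a finitely generated submonoid and let f : S → ℝ be a superadditive map (f(s) + f(t) ≤ f(s + t) for all s, t ∈ S) such that for every s ∈ S there is κ_s ∈ ℤ_{>0} with f(iκ_s s) = i·f(κ_s s) for all i ∈ ℕ. Then there is a unique superlinear function f^♯ : S_ℝ → ℝ such that for every s ∈ S there exists λ_s ∈ ℤ_{>0} with f(λ_s s) = f^♯(λ_s s). Furthermore, for every rational polyhedral cone C ⊆ S_ℝ the following are equivalent: (i) there is κ ∈ ℤ_{>0} such that f(κs + κt) = f(κs) + f(κt) for all s, t ∈ C ∩ S; (ii) the restriction of f^♯ to C is linear. -/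
/-- The natural embedding `ℕʳ → ℝʳ`. -/
def natToReal {r : ℕ} (s : Fin r → ℕ) : Fin r → ℝ := fun j => (s j : ℝ)

/-- The set of all finite nonnegative real linear combinations of elements of a set
`S ⊆ ℕʳ`, viewed inside `ℝʳ`: this is `S_ℝ`. -/
def natConeHull {r : ℕ} (S : Set (Fin r → ℕ)) : Set (Fin r → ℝ) :=
  {x | ∃ (k : ℕ) (c : Fin k → ℝ) (s : Fin k → Fin r → ℕ),
    (∀ i, 0 ≤ c i) ∧ (∀ i, s i ∈ S) ∧ x = ∑ i, c i • natToReal (s i)}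

/-- A rational polyhedral cone in `ℝʳ`: the set of nonnegative real combinations of
finitely many rational vectors. -/
def IsRationalPolyhedralCone {r : ℕ} (C : Set (Fin r → ℝ)) : Prop :=
  ∃ (k : ℕ) (v : Fin k → Fin r → ℚ),
    C = {x | ∃ c : Fin k → ℝ, (∀ i, 0 ≤ c i) ∧ x = ∑ i, c i • fun j => ((v i j : ℝ))}

/-- A function `F` is superlinear on a set `C ⊆ ℝʳ`. -/
def SuperlinearOn {r : ℕ} (F : (Fin r → ℝ) → ℝ) (C : Set (Fin r → ℝ)) : Prop :=
  ∀ x ∈ C, ∀ y ∈ C, ∀ a b : ℝ, 0 ≤ a → 0 ≤ b →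
    a * F x + b * F y ≤ F (a • x + b • y)

open Filter Topology
open scoped NNReal

/-- `natToReal` as an additive homomorphism. -/
def natToRealHom (r : ℕ) : (Fin r → ℕ) →+ (Fin r → ℝ) where
  toFun := natToReal
  map_zero' := by ext; simp [natToReal]
  map_add' s t := by ext; simp [natToReal]

lemma natToRealHom_apply {r : ℕ} (s : Fin r → ℕ) : natToRealHom r s = natToReal s := rfl

lemma natToReal_add {r : ℕ} (s t : Fin r → ℕ) :
    natToReal (s + t) = natToReal s + natToReal t :=
  map_add (natToRealHom r) s t

lemma natToReal_nsmul {r : ℕ} (n : ℕ) (s : Fin r → ℕ) :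
    natToReal (n • s) = (n : ℝ) • natToReal s := by
  ext; simp [natToReal]

lemma natToReal_sum_nsmul {r : ℕ} {ι : Type*} (t : Finset ι) (n : ι → ℕ) (u : ι → Fin r → ℕ) :
    natToReal (∑ i ∈ t, n i • u i) = ∑ i ∈ t, (n i : ℝ) • natToReal (u i) := by
  rw [← natToRealHom_apply, map_sum]
  simp only [natToRealHom_apply, natToReal_nsmul]

/-- The real numbers can be approximated pointwise by `ℚ`-linear maps to `ℚ`. -/
lemma exists_rat_linearMap_tendsto :
    ∃ φ : ℕ → ℝ →ₗ[ℚ] ℚ, ∀ x : ℝ, Tendsto (fun m => (φ m x : ℝ)) atTop (𝓝 x) := by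
  let b := Module.Basis.ofVectorSpace ℚ ℝ
  choose a ha using fun i => Real.exists_seq_rat_strictMono_tendsto (b i)
  refine ⟨fun m => b.constr ℚ fun i => a i m, fun x => ?_⟩
  have hx : x = ∑ i ∈ (b.repr x).support, (b.repr x i : ℝ) * b i := by
    conv_lhs => rw [← b.linearCombination_repr x, Finsupp.linearCombination_apply, Finsupp.sum]
    simp only [Rat.smul_def]
  have hφ : ∀ m, ((b.constr ℚ fun i => a i m) x : ℝ) =
      ∑ i ∈ (b.repr x).support, (b.repr x i : ℝ) * a i m := by
    intro m
    rw [Module.Basis.constr_apply, Finsupp.sum]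
    push_cast [smul_eq_mul]
    rfl
  simp only [hφ]
  conv => rhs; rw [hx]
  exact tendsto_finsetSum _ fun i _ => (ha i).2.2.const_mul _

lemma exists_nat_eq_mul_rat {ι : Type*} [Fintype ι] (q : ι → ℚ) (hq : ∀ i, 0 ≤ q i) :
    ∃ D : ℕ, 0 < D ∧ ∃ n : ι → ℕ, ∀ i, (n i : ℚ) = D * q i := by
  classical
  refine ⟨∏ i, (q i).den, Finset.prod_pos fun i _ => (q i).den_pos,
    fun i => (∏ j ∈ Finset.univ.erase i, (q j).den) * (q i).num.toNat, fun i => ?_⟩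
  rw [← Finset.mul_prod_erase _ _ (Finset.mem_univ i)]
  have h1 : (((q i).num.toNat : ℕ) : ℚ) = (q i).num := by
    exact_mod_cast Int.toNat_of_nonneg (Rat.num_nonneg.2 (hq i))
  have h2 := Rat.den_mul_eq_num (q i)
  push_cast
  rw [h1, ← h2]
  ring

/-- A linear inequality that holds at all natural solutions `(N, n)` of `N w = ∑ nᵢ uᵢ` also holds
at all nonnegative real solutions `(1, c)`. -/
lemma sum_mul_le_of_forall_nat {r : ℕ} {ι : Type*} [Fintype ι] (w : Fin r → ℕ)
    (u : ι → Fin r → ℕ) (c : ι → ℝ) (hc : ∀ i, 0 ≤ c i)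
    (hw : natToReal w = ∑ i, c i • natToReal (u i)) (g : ι → ℝ) (W : ℝ)
    (h : ∀ N : ℕ, 0 < N → ∀ n : ι → ℕ, N • w = ∑ i, n i • u i → ∑ i, n i * g i ≤ N * W) :
    ∑ i, c i * g i ≤ W := by
  obtain ⟨φ, hφ⟩ := exists_rat_linearMap_tendsto
  have hnonneg : ∀ x : ℝ, 0 ≤ x → ∀ᶠ m in atTop, 0 ≤ φ m x := by
    intro x hx
    rcases hx.eq_or_lt with rfl | hx
    · simp
    · filter_upwards [(hφ x).eventually (lt_mem_nhds hx)] with m hm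
      exact_mod_cast hm.le
  have hone : ∀ᶠ m in atTop, 0 < φ m 1 := by
    filter_upwards [(hφ 1).eventually (lt_mem_nhds one_pos)] with m hm
    exact_mod_cast hm
  have hall : ∀ᶠ m in atTop, ∀ i, 0 ≤ φ m (c i) := eventually_all.2 fun i => hnonneg _ (hc i)
  have hle : ∀ᶠ m in atTop, ∑ i, (φ m (c i) : ℝ) * g i ≤ (φ m 1 : ℝ) * W := by
    filter_upwards [hone, hall] with m h1 h2
    obtain ⟨D, hD, n, hn⟩ := exists_nat_eq_mul_rat
      (fun i : Option ι => i.elim (φ m 1) fun i => φ m (c i))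
      (by rintro (_ | i); exacts [h1.le, h2 i])
    have hn0 : (n none : ℚ) = D * φ m 1 := hn none
    have hni : ∀ i, (n (some i) : ℚ) = D * φ m (c i) := fun i => hn (some i)
    have hDQ : (0 : ℚ) < D := by exact_mod_cast hD
    have hN : 0 < n none := by
      have : (0 : ℚ) < n none := by rw [hn0]; positivity
      exact_mod_cast this
    have key := h (n none) hN (fun i => n (some i)) (by
      ext j
      have hj : (w j : ℝ) = ∑ i, c i * u i j := by
        simpa [natToReal, Finset.sum_apply] using congrFun hw j
      have hj' : (w j : ℚ) * φ m 1 = ∑ i, φ m (c i) * u i j := by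
        have e := congrArg (φ m) hj
        have e1 : ∀ (x : ℝ) (k : ℕ), φ m (x * k) = φ m x * k := fun x k => by
          rw [mul_comm, ← nsmul_eq_mul, map_nsmul, nsmul_eq_mul, mul_comm]
        rw [map_sum] at e
        simp only [e1] at e
        rw [← e, mul_comm, ← e1, one_mul]
      have : ((n none * w j : ℕ) : ℚ) = ((∑ i, n (some i) * u i j : ℕ) : ℚ) := by
        push_cast
        simp only [hn0, hni, mul_assoc, ← Finset.mul_sum]
        rw [← hj', mul_comm (w j : ℚ)]
      simpa [Finset.sum_apply] using (by exact_mod_cast this :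
        n none * w j = ∑ i, n (some i) * u i j))
    have hn0' : (n none : ℝ) = D * φ m 1 := by exact_mod_cast congrArg (Rat.cast : ℚ → ℝ) hn0
    have hni' : ∀ i, (n (some i) : ℝ) = D * φ m (c i) := fun i => by
      exact_mod_cast congrArg (Rat.cast : ℚ → ℝ) (hni i)
    simp only [hn0', hni', mul_assoc, ← Finset.mul_sum] at key
    exact le_of_mul_le_mul_left key (by exact_mod_cast hD)
  refine le_of_tendsto_of_tendsto (tendsto_finsetSum _ fun i _ => (hφ (c i)).mul_const _) ?_ hle
  simpa using (hφ 1).mul_const W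

lemma exists_nsmul_eq_sum_nsmul {r : ℕ} {ι : Type*} [Fintype ι] (w : Fin r → ℕ)
    (u : ι → Fin r → ℕ) (c : ι → ℝ) (hc : ∀ i, 0 ≤ c i)
    (hw : natToReal w = ∑ i, c i • natToReal (u i)) :
    ∃ N : ℕ, 0 < N ∧ ∃ n : ι → ℕ, N • w = ∑ i, n i • u i := by
  by_contra hcon
  have := sum_mul_le_of_forall_nat w u c hc hw 0 (-1)
    fun N hN n hn => (hcon ⟨N, hN, n, hn⟩).elim
  simp at this
  linarith

/-- The convex cone in `ℝʳ` generated by a set of natural vectors. -/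
noncomputable def natCone {r : ℕ} (A : Set (Fin r → ℕ)) : Submodule ℝ≥0 (Fin r → ℝ) :=
  Submodule.span ℝ≥0 (natToReal '' A)

lemma natToReal_mem_natCone {r : ℕ} {A : Set (Fin r → ℕ)} {s : Fin r → ℕ} (hs : s ∈ A) :
    natToReal s ∈ natCone A :=
  Submodule.subset_span ⟨s, hs, rfl⟩

lemma smul_mem_of_nonneg {E : Type*} [AddCommGroup E] [Module ℝ E] (K : Submodule ℝ≥0 E)
    {x : E} (hx : x ∈ K) {a : ℝ} (ha : 0 ≤ a) : a • x ∈ K :=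
  K.smul_mem ⟨a, ha⟩ hx

lemma coe_natCone {r : ℕ} (A : Set (Fin r → ℕ)) :
    (natCone A : Set (Fin r → ℝ)) = natConeHull A := by
  ext x
  constructor
  · intro hx
    obtain ⟨n, c, v, rfl⟩ := Submodule.mem_span_set'.1 hx
    choose s hs hv using fun i => (v i).2
    exact ⟨n, fun i => c i, s, fun i => (c i).2, hs, by simp only [hv]; rfl⟩
  · rintro ⟨n, c, s, hc, hs, rfl⟩
    exact sum_mem fun i _ => smul_mem_of_nonneg _ (natToReal_mem_natCone (hs i)) (hc i)

lemma mem_natCone_iff {r : ℕ} {A : Set (Fin r → ℕ)} {x : Fin r → ℝ} :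
    x ∈ natCone A ↔ x ∈ natConeHull A := by
  rw [← coe_natCone, SetLike.mem_coe]

lemma mem_natCone_range {r : ℕ} {ι : Type*} [Fintype ι] (u : ι → Fin r → ℕ) (x : Fin r → ℝ) :
    x ∈ natCone (Set.range u) ↔ ∃ c : ι → ℝ, (∀ i, 0 ≤ c i) ∧ x = ∑ i, c i • natToReal (u i) := by
  rw [natCone, ← Set.range_comp, Submodule.mem_span_range_iff_exists_fun]
  constructor
  · rintro ⟨c, rfl⟩
    exact ⟨fun i => c i, fun i => (c i).2, rfl⟩
  · rintro ⟨c, hc, rfl⟩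
    exact ⟨fun i => ⟨c i, hc i⟩, rfl⟩

/-- The saturation of a finitely generated submonoid of `ℕᵐ` is finitely generated. -/
lemma fg_of_mem_iff_exists_nsmul_mem {m : ℕ} {P Q : AddSubmonoid (Fin m → ℕ)} (hQ : Q.FG)
    (h : ∀ a, a ∈ P ↔ ∃ N : ℕ, 0 < N ∧ N • a ∈ Q) : P.FG := by
  obtain ⟨T, rfl⟩ := hQ
  have hT : ∀ t ∈ T, t ∈ P := fun t ht =>
    (h t).2 ⟨1, one_pos, by
      rw [one_smul]; exact AddSubmonoid.subset_closure (Finset.mem_coe.2 ht)⟩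
  rw [AddSubmonoid.fg_iff]
  refine ⟨(T : Set (Fin m → ℕ)) ∪ {a | a ∈ P ∧ a ≤ ∑ t : T, t.1}, le_antisymm ?_ ?_, ?_⟩
  · rw [AddSubmonoid.closure_le]
    rintro a (ha | ha)
    exacts [hT a ha, ha.1]
  · intro a ha
    obtain ⟨N, hN, hNa⟩ := (h a).1 ha
    obtain ⟨n, hn⟩ := AddSubmonoid.mem_closure_finset'.1 hNa
    have hsplit : N • ∑ i : T, (n i / N) • i.1 + ∑ i : T, (n i % N) • i.1 = N • a := by
      rw [hn, Finset.smul_sum, ← Finset.sum_add_distrib]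
      refine Finset.sum_congr rfl fun i _ => ?_
      rw [smul_smul, ← add_smul, Nat.div_add_mod]
    have hle : ∑ i : T, (n i / N) • i.1 ≤ a := fun j => by
      have := congrFun hsplit j
      simp only [Pi.add_apply, Pi.smul_apply, smul_eq_mul] at this
      exact le_of_mul_le_mul_left (this ▸ Nat.le_add_right _ _) hN
    obtain ⟨d, rfl⟩ := exists_add_of_le hle
    rw [smul_add] at hsplit
    have hd := (add_left_cancel hsplit).symm
    refine add_mem (sum_mem fun i _ => AddSubmonoid.nsmul_mem _
      (AddSubmonoid.subset_closure (Set.mem_union_left _ i.2)) _)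
      (AddSubmonoid.subset_closure (Set.mem_union_right _ ⟨(h d).2 ⟨N, hN, ?_⟩, fun j => ?_⟩))
    · rw [hd]
      exact sum_mem fun i _ => AddSubmonoid.nsmul_mem _ (AddSubmonoid.subset_closure i.2) _
    · refine le_of_mul_le_mul_left ?_ hN
      have := congrFun hd j
      simp only [Pi.smul_apply, smul_eq_mul, Finset.sum_apply] at this
      rw [this, Finset.sum_apply, Finset.mul_sum]
      exact Finset.sum_le_sum fun i _ => Nat.mul_le_mul_right _ (Nat.mod_lt _ hN).le
  · exact T.finite_toSet.union ((Set.finite_Iic _).subset fun a ha => ha.2)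

/-- **Gordan's lemma** for the intersection of a finitely generated submonoid of `ℕʳ` with a
rational polyhedral cone. -/
lemma fg_inf_comap_natCone {r : ℕ} {ι : Type*} [Fintype ι] {S : AddSubmonoid (Fin r → ℕ)}
    (hS : S.FG) (u : ι → Fin r → ℕ) :
    (S ⊓ (natCone (Set.range u)).toAddSubmonoid.comap (natToRealHom r)).FG := by
  obtain ⟨m, π, rfl⟩ := AddSubmonoid.fg_iff_exists_fin_addMonoidHom.1 hS
  rw [inf_comm, ← AddSubmonoid.map_comap_eq]
  refine AddSubmonoid.FG.map ?_ _
  let σ : (ι → ℕ) →+ (Fin r → ℕ) :=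
    ∑ i, (AddMonoidHom.flip (smulAddHom ℕ (Fin r → ℕ)) (u i)).comp (Pi.evalAddMonoidHom _ i)
  have hσ : ∀ n, σ n = ∑ i, n i • u i := fun n => by simp [σ]
  let L := (π.comp (AddMonoidHom.fst (Fin m → ℕ) (ι → ℕ))).eqLocusM
    (σ.comp (AddMonoidHom.snd (Fin m → ℕ) (ι → ℕ)))
  have hL : ∀ a n, (a, n) ∈ L ↔ π a = ∑ i, n i • u i := fun a n => by
    rw [← hσ]; rfl
  have hfg : L.FG := AddSubmonoid.fg_eqLocusM _ _
  refine fg_of_mem_iff_exists_nsmul_mem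
    (hfg.map (AddMonoidHom.fst (Fin m → ℕ) (ι → ℕ))) fun a => ?_
  have hmem : a ∈ ((natCone (Set.range u)).toAddSubmonoid.comap (natToRealHom r)).comap π ↔
      natToReal (π a) ∈ natCone (Set.range u) := Iff.rfl
  rw [hmem, mem_natCone_range]
  constructor
  · rintro ⟨c, hc, hx⟩
    obtain ⟨N, hN, n, hn⟩ := exists_nsmul_eq_sum_nsmul _ _ c hc hx
    exact ⟨N, hN, (N • a, n), (hL _ _).2 (by rw [map_nsmul, hn]), rfl⟩
  · rintro ⟨N, hN, ⟨b, n⟩, hb, rfl : b = N • a⟩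
    have e := (hL _ _).1 hb
    have hN' : (N : ℝ) ≠ 0 := by positivity
    refine ⟨fun i => (N : ℝ)⁻¹ * n i, fun i => by positivity, ?_⟩
    simp only [mul_smul, ← Finset.smul_sum]
    rw [← natToReal_sum_nsmul, ← e, map_nsmul, natToReal_nsmul, inv_smul_smul₀ hN']

/-- A rational polyhedral cone inside `S_ℝ` is generated by finitely many elements of `S`. -/
lemma IsRationalPolyhedralCone.exists_eq_natCone {r : ℕ} {S : AddSubmonoid (Fin r → ℕ)}
    {C : Set (Fin r → ℝ)} (hC : IsRationalPolyhedralCone C)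
    (hCS : C ⊆ natConeHull (S : Set (Fin r → ℕ))) :
    ∃ (k : ℕ) (u : Fin k → Fin r → ℕ), (∀ i, u i ∈ S) ∧
      C = (natCone (Set.range u) : Set (Fin r → ℝ)) := by
  obtain ⟨k, v, rfl⟩ := hC
  have hv : ∀ i, ∃ D : ℕ, 0 < D ∧ ∃ w ∈ S, natToReal w = (D : ℝ) • fun j => (v i j : ℝ) := by
    intro i
    have hvi : ∃ c : Fin k → ℝ, (∀ l, 0 ≤ c l) ∧
        (fun j => (v i j : ℝ)) = ∑ l, c l • fun j => (v l j : ℝ) :=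
      ⟨Pi.single i 1, fun l => (Pi.single_nonneg.2 zero_le_one : (0 : Fin k → ℝ) ≤ Pi.single i 1) l,
        by simp [Pi.single_apply]⟩
    obtain ⟨p, c, s, hc, hs, hx⟩ := hCS hvi
    have hnn : ∀ j, 0 ≤ v i j := fun j => by
      have := congrFun hx j
      have h0 : (0 : ℝ) ≤ v i j := by
        rw [this, Finset.sum_apply]
        exact Finset.sum_nonneg fun l _ => mul_nonneg (hc l) (Nat.cast_nonneg _)
      exact_mod_cast h0
    obtain ⟨D, hD, w, hw⟩ := exists_nat_eq_mul_rat (v i) hnn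
    have hwv : natToReal w = (D : ℝ) • fun j => (v i j : ℝ) := by
      ext j
      have := congrArg (Rat.cast : ℚ → ℝ) (hw j)
      simpa [natToReal] using this
    obtain ⟨N, hN, n, hn⟩ := exists_nsmul_eq_sum_nsmul w s (fun l => D * c l)
      (fun l => mul_nonneg D.cast_nonneg (hc l)) (by
        rw [hwv, hx, Finset.smul_sum]; simp only [mul_smul])
    refine ⟨N * D, Nat.mul_pos hN hD, N • w, ?_, ?_⟩
    · rw [hn]
      exact sum_mem fun l _ => AddSubmonoid.nsmul_mem _ (hs l) _
    · rw [natToReal_nsmul, hwv, smul_smul, Nat.cast_mul]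
  choose D hD u hu huv using hv
  refine ⟨k, u, hu, Set.ext fun x => ?_⟩
  rw [SetLike.mem_coe, mem_natCone_range]
  have hD' : ∀ i, (D i : ℝ) ≠ 0 := fun i => by have := hD i; positivity
  constructor
  · rintro ⟨c, hc, rfl⟩
    refine ⟨fun i => c i * (D i : ℝ)⁻¹, fun i => by have := hc i; positivity, ?_⟩
    refine Finset.sum_congr rfl fun i _ => ?_
    rw [huv, smul_smul, inv_mul_cancel_right₀ (hD' i)]
  · rintro ⟨c, hc, rfl⟩
    refine ⟨fun i => c i * D i, fun i => by have := hc i; positivity, ?_⟩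
    refine Finset.sum_congr rfl fun i _ => ?_
    rw [huv, smul_smul]

lemma SuperlinearOn.map_smul {r : ℕ} {G : (Fin r → ℝ) → ℝ} {K : Submodule ℝ≥0 (Fin r → ℝ)}
    (hG : SuperlinearOn G K) {x : Fin r → ℝ} (hx : x ∈ K) {a : ℝ} (ha : 0 ≤ a) :
    G (a • x) = a * G x := by
  have hle : ∀ y ∈ K, ∀ b : ℝ, 0 ≤ b → b * G y ≤ G (b • y) := fun y hy b hb => by
    simpa using hG y hy y hy b 0 hb le_rfl
  rcases ha.eq_or_lt with rfl | ha'
  · have h0 := hle x hx 0 le_rfl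
    have h1 := hG 0 K.zero_mem 0 K.zero_mem 1 1 zero_le_one zero_le_one
    simp only [zero_smul, smul_zero, add_zero] at h0 h1 ⊢
    linarith
  · refine le_antisymm ?_ (hle x hx a ha)
    have := hle _ (smul_mem_of_nonneg K hx ha) a⁻¹ (inv_nonneg.2 ha)
    rwa [inv_smul_smul₀ ha'.ne', inv_mul_le_iff₀ ha'] at this

lemma SuperlinearOn.add_le {r : ℕ} {G : (Fin r → ℝ) → ℝ} {K : Submodule ℝ≥0 (Fin r → ℝ)}
    (hG : SuperlinearOn G K) {x y : Fin r → ℝ} (hx : x ∈ K) (hy : y ∈ K) :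
    G x + G y ≤ G (x + y) := by
  simpa using hG x hx y hy 1 1 zero_le_one zero_le_one

lemma SuperlinearOn.sum_le {r : ℕ} {G : (Fin r → ℝ) → ℝ} {K : Submodule ℝ≥0 (Fin r → ℝ)}
    (hG : SuperlinearOn G K) {ι : Type*} (t : Finset ι) {c : ι → ℝ} (hc : ∀ i, 0 ≤ c i)
    {v : ι → Fin r → ℝ} (hv : ∀ i, v i ∈ K) :
    ∑ i ∈ t, c i * G (v i) ≤ G (∑ i ∈ t, c i • v i) := by
  classical
  induction t using Finset.induction_on with
  | empty => simpa using (hG.map_smul K.zero_mem le_rfl).ge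
  | insert i t hi ih =>
    rw [Finset.sum_insert hi, Finset.sum_insert hi, ← hG.map_smul (hv i) (hc i)]
    refine (add_le_add_right ih _).trans (hG.add_le (smul_mem_of_nonneg K (hv i) (hc i)) ?_)
    exact sum_mem fun j _ => smul_mem_of_nonneg K (hv j) (hc j)

/-- The homogeneous superadditive function attached to a superadditive function that is additive up
to truncation along every ray. -/
lemma exists_homogenization {M : Type*} [AddCommMonoid M] (S : AddSubmonoid M) (f : M → ℝ)
    (hsuper : ∀ s ∈ S, ∀ t ∈ S, f s + f t ≤ f (s + t))
    (htrunc : ∀ s ∈ S, ∃ κ : ℕ, 0 < κ ∧ ∀ i : ℕ, f ((i * κ) • s) = i * f (κ • s)) :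
    ∃ g : M → ℝ, (∀ s ∈ S, ∀ t ∈ S, g s + g t ≤ g (s + t)) ∧
      (∀ s ∈ S, ∀ n : ℕ, g (n • s) = n * g s) ∧ (∀ s ∈ S, f s ≤ g s) ∧
      ∀ s ∈ S, ∃ l : ℕ, 0 < l ∧ ∀ i : ℕ, f ((i * l) • s) = i * l * g s := by
  choose! κ hκ hf using htrunc
  let g : M → ℝ := fun s => f (κ s • s) / κ s
  have hg : ∀ s ∈ S, ∀ i : ℕ, f ((i * κ s) • s) = i * κ s * g s := fun s hs i => by
    have := hκ s hs
    rw [hf s hs]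
    simp only [g]
    field_simp
  have hle : ∀ s ∈ S, ∀ n : ℕ, n * f s ≤ f (n • s) := by
    intro s hs n
    induction n with
    | zero => simpa using (hg s hs 0).ge
    | succ n ih =>
      have := hsuper _ (S.nsmul_mem hs n) _ hs
      rw [succ_nsmul]
      push_cast
      linarith
  refine ⟨g, fun s hs t ht => ?_, fun s hs n => ?_, fun s hs => ?_,
    fun s hs => ⟨κ s, hκ s hs, hg s hs⟩⟩
  · have hst := S.add_mem hs ht
    have h1 := hg s hs (κ t * κ (s + t))
    have h2 := hg t ht (κ s * κ (s + t))
    have h3 := hg (s + t) hst (κ s * κ t)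
    have h4 := hsuper _ (S.nsmul_mem hs (κ s * κ t * κ (s + t))) _
      (S.nsmul_mem ht (κ s * κ t * κ (s + t)))
    rw [← smul_add, h3, show κ s * κ t * κ (s + t) = κ t * κ (s + t) * κ s by ring, h1,
      show κ t * κ (s + t) * κ s = κ s * κ (s + t) * κ t by ring, h2] at h4
    have hpos : (0 : ℝ) < κ s * κ t * κ (s + t) := by
      exact_mod_cast Nat.mul_pos (Nat.mul_pos (hκ s hs) (hκ t ht)) (hκ _ hst)
    refine le_of_mul_le_mul_left ?_ hpos
    push_cast at h4
    linarith
  · have hns := S.nsmul_mem hs n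
    have h1 := hg (n • s) hns (κ s)
    have h2 := hg s hs (κ (n • s) * n)
    rw [smul_smul, show κ s * κ (n • s) * n = κ (n • s) * n * κ s by ring, h2] at h1
    have hpos : (0 : ℝ) < κ s * κ (n • s) := by
      exact_mod_cast Nat.mul_pos (hκ s hs) (hκ _ hns)
    refine mul_left_cancel₀ hpos.ne' ?_
    push_cast at h1
    linarith
  · have h1 := hle s hs (κ s)
    have h2 := hg s hs 1
    rw [one_mul, Nat.cast_one, one_mul] at h2
    rw [h2] at h1
    exact le_of_mul_le_mul_left h1 (by exact_mod_cast hκ s hs)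

/-- A homogeneous superadditive function on `S` extends to a superlinear function on `S_ℝ`. -/
lemma exists_superlinearOn_natCone {r : ℕ} (S : AddSubmonoid (Fin r → ℕ)) (g : (Fin r → ℕ) → ℝ)
    (hadd : ∀ s ∈ S, ∀ t ∈ S, g s + g t ≤ g (s + t))
    (hsmul : ∀ s ∈ S, ∀ n : ℕ, g (n • s) = n * g s) :
    ∃ F : (Fin r → ℝ) → ℝ, SuperlinearOn F (natCone (S : Set (Fin r → ℕ))) ∧
      ∀ s ∈ S, F (natToReal s) = g s := by
  let P : Submodule ℝ≥0 ((Fin r → ℝ) × ℝ) :=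
    Submodule.span ℝ≥0 ((fun s => (natToReal s, g s)) '' (S : Set (Fin r → ℕ)))
  have hgP : ∀ s ∈ S, (natToReal s, g s) ∈ P := fun s hs => Submodule.subset_span ⟨s, hs, rfl⟩
  have hsum : ∀ (k : ℕ) (s : Fin k → Fin r → ℕ) (n : Fin k → ℕ), (∀ i, s i ∈ S) →
      ∑ i, n i * g (s i) ≤ g (∑ i, n i • s i) := by
    intro k s n hs
    have := Finset.le_sum_of_subadditive_on_pred (fun t => -g t) (· ∈ S) (by
        simpa using (hsmul 0 S.zero_mem 0).ge) (fun a b ha hb => by linarith [hadd a ha b hb])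
        (fun a b ha hb => S.add_mem ha hb) (fun i => n i • s i) (s := Finset.univ)
        fun i _ => S.nsmul_mem (hs i) _
    rw [Finset.sum_neg_distrib, neg_le_neg_iff] at this
    simpa only [hsmul _ (hs _)] using this
  have hPg : ∀ w ∈ S, ∀ y, (natToReal w, y) ∈ P → y ≤ g w := by
    intro w hw y hy
    obtain ⟨k, c, v, hv⟩ := Submodule.mem_span_set'.1 hy
    choose s hs hsv using fun i => (v i).2
    have h1 := congrArg Prod.fst hv
    have h2 := congrArg Prod.snd hv
    simp only [← hsv, Prod.fst_sum, Prod.snd_sum, Prod.smul_fst, Prod.smul_snd] at h1 h2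
    rw [← h2]
    refine sum_mul_le_of_forall_nat w s (fun i => c i) (fun i => (c i).2) h1.symm
      (fun i => g (s i)) (g w) fun N _ n hn => ?_
    rw [← hsmul w hw, hn]
    exact hsum k s n hs
  have hne : ∀ x ∈ natCone (S : Set (Fin r → ℕ)), {y | (x, y) ∈ P}.Nonempty := by
    intro x hx
    induction hx using Submodule.span_induction with
    | mem x hx =>
      obtain ⟨s, hs, rfl⟩ := hx
      exact ⟨g s, hgP s hs⟩
    | zero => exact ⟨0, P.zero_mem⟩
    | add x y _ _ hx hy =>
      obtain ⟨a, ha⟩ := hx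
      obtain ⟨b, hb⟩ := hy
      exact ⟨a + b, P.add_mem ha hb⟩
    | smul c x _ hx =>
      obtain ⟨a, ha⟩ := hx
      exact ⟨c • a, P.smul_mem c ha⟩
  have hbdd : ∀ x ∈ natCone (S : Set (Fin r → ℕ)), BddAbove {y | (x, y) ∈ P} := by
    intro x hx
    obtain ⟨k, c, s, hc, hs, rfl⟩ := mem_natCone_iff.1 hx
    have hz : ∑ i, ((⌈c i⌉₊ : ℝ) - c i) • natToReal (s i) ∈ natCone (S : Set (Fin r → ℕ)) :=
      sum_mem fun i _ => smul_mem_of_nonneg _ (natToReal_mem_natCone (hs i))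
        (sub_nonneg.2 (Nat.le_ceil _))
    obtain ⟨v, hv⟩ := hne _ hz
    have hw : ∑ i, ⌈c i⌉₊ • s i ∈ S := sum_mem fun i _ => S.nsmul_mem (hs i) _
    refine ⟨g (∑ i, ⌈c i⌉₊ • s i) - v, fun y hy => le_sub_iff_add_le.2 (hPg _ hw _ ?_)⟩
    have := P.add_mem hy hv
    rw [Prod.mk_add_mk, ← Finset.sum_add_distrib] at this
    simpa only [← add_smul, add_sub_cancel, natToReal_sum_nsmul] using this
  refine ⟨fun x => sSup {y | (x, y) ∈ P}, fun x hx y hy a b ha hb => ?_, fun s hs => ?_⟩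
  · have hxy : a • x + b • y ∈ natCone (S : Set (Fin r → ℕ)) :=
      add_mem (smul_mem_of_nonneg _ hx ha) (smul_mem_of_nonneg _ hy hb)
    have hcont : Continuous fun p : ℝ × ℝ => a * p.1 + b * p.2 := by fun_prop
    have := map_mem_closure₂ (f := fun p q => a * p + b * q)
      (u := Set.Iic (sSup {z | (a • x + b • y, z) ∈ P})) hcont
      (csSup_mem_closure (hne x hx) (hbdd x hx)) (csSup_mem_closure (hne y hy) (hbdd y hy))
      fun p hp q hq => le_csSup (hbdd _ hxy)
        (P.add_mem (smul_mem_of_nonneg P hp ha) (smul_mem_of_nonneg P hq hb))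
    rwa [closure_Iic] at this
  · have hs' : natToReal s ∈ natCone (S : Set (Fin r → ℕ)) := natToReal_mem_natCone hs
    exact le_antisymm (csSup_le (hne _ hs') fun y hy => hPg s hs y hy)
      (le_csSup (hbdd _ hs') (hgP s hs))

/-- A superlinear function on `S_ℝ` is bounded above by any other one with the same values
on `S`. -/
lemma SuperlinearOn.le_of_eqOn {r : ℕ} {S : AddSubmonoid (Fin r → ℕ)} {F G : (Fin r → ℝ) → ℝ}
    (hF : SuperlinearOn F (natCone (S : Set (Fin r → ℕ))))
    (hG : SuperlinearOn G (natCone (S : Set (Fin r → ℕ))))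
    (h : ∀ s ∈ S, G (natToReal s) = F (natToReal s)) {x : Fin r → ℝ}
    (hx : x ∈ natCone (S : Set (Fin r → ℕ))) : G x ≤ F x := by
  obtain ⟨k, c, s, hc, hs, hxs⟩ := mem_natCone_iff.1 hx
  have hsK : ∀ i, natToReal (s i) ∈ natCone (S : Set (Fin r → ℕ)) := fun i =>
    natToReal_mem_natCone (hs i)
  have key : ∀ δ : ℝ, 0 < δ → G x ≤ F x + δ * (F x - ∑ i, c i * F (natToReal (s i))) := by
    intro δ hδ
    have hev : ∀ᶠ N : ℕ in atTop, ∀ i, (⌈N * c i⌉₊ : ℝ) ≤ N * ((1 + δ) * c i) := by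
      refine eventually_all.2 fun i => ?_
      rcases (hc i).eq_or_lt with h0 | h0
      · simp [← h0]
      · obtain ⟨M, hM⟩ := exists_nat_ge (1 / (δ * c i))
        filter_upwards [eventually_ge_atTop M] with N hN
        have hNM : 1 / (δ * c i) ≤ N := hM.trans (by exact_mod_cast hN)
        rw [div_le_iff₀ (by positivity)] at hNM
        have := Nat.ceil_lt_add_one (show 0 ≤ N * c i by positivity)
        linarith
    obtain ⟨N, hN, hNpos⟩ := (hev.and (eventually_gt_atTop 0)).exists
    have hp : ∑ i, ⌈N * c i⌉₊ • s i ∈ S := sum_mem fun i _ => S.nsmul_mem (hs i) _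
    have hpK := natToReal_mem_natCone (A := (S : Set (Fin r → ℕ))) hp
    have h1 := hG.sum_le Finset.univ (fun i => sub_nonneg.2 (Nat.le_ceil (N * c i))) hsK
    have h2 := hF.sum_le Finset.univ (fun i => sub_nonneg.2 (hN i)) hsK
    have h3 := hG.add_le (smul_mem_of_nonneg _ hx N.cast_nonneg)
      (sum_mem fun i (_ : i ∈ Finset.univ) =>
        smul_mem_of_nonneg _ (hsK i) (sub_nonneg.2 (Nat.le_ceil (N * c i))))
    have h4 := hF.add_le hpK (sum_mem fun i (_ : i ∈ Finset.univ) =>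
        smul_mem_of_nonneg _ (hsK i) (sub_nonneg.2 (hN i)))
    have e1 : (N : ℝ) • x + ∑ i, ((⌈N * c i⌉₊ : ℝ) - N * c i) • natToReal (s i) =
        natToReal (∑ i, ⌈N * c i⌉₊ • s i) := by
      rw [hxs, natToReal_sum_nsmul, Finset.smul_sum, ← Finset.sum_add_distrib]
      refine Finset.sum_congr rfl fun i _ => ?_
      module
    have e2 : natToReal (∑ i, ⌈N * c i⌉₊ • s i) +
        ∑ i, (N * ((1 + δ) * c i) - (⌈N * c i⌉₊ : ℝ)) • natToReal (s i) =
        (N * (1 + δ)) • x := by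
      rw [hxs, natToReal_sum_nsmul, Finset.smul_sum, ← Finset.sum_add_distrib]
      refine Finset.sum_congr rfl fun i _ => ?_
      module
    rw [e1, hG.map_smul hx N.cast_nonneg, h _ hp] at h3
    rw [e2, hF.map_smul hx (by positivity)] at h4
    simp only [h _ (hs _)] at h1
    have e3 : ∑ i, ((⌈N * c i⌉₊ : ℝ) - N * c i) * F (natToReal (s i)) +
        ∑ i, (N * ((1 + δ) * c i) - (⌈N * c i⌉₊ : ℝ)) * F (natToReal (s i)) =
        N * (δ * ∑ i, c i * F (natToReal (s i))) := by
      rw [← Finset.sum_add_distrib, Finset.mul_sum, Finset.mul_sum]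
      refine Finset.sum_congr rfl fun i _ => ?_
      ring
    have hN0 : (0 : ℝ) < N := by exact_mod_cast hNpos
    refine le_of_mul_le_mul_left ?_ hN0
    linarith
  have hlim : Tendsto (fun δ : ℝ => F x + δ * (F x - ∑ i, c i * F (natToReal (s i))))
      (𝓝[>] 0) (𝓝 (F x)) := by
    have : Continuous fun δ : ℝ => F x + δ * (F x - ∑ i, c i * F (natToReal (s i))) := by
      fun_prop
    simpa using (this.tendsto 0).mono_left nhdsWithin_le_nhds
  exact ge_of_tendsto hlim (eventually_mem_nhdsWithin.mono fun δ hδ => key δ hδ)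

/-- A superlinear function on `S_ℝ` that is additive on the lattice points of a polyhedral cone
is linear on that cone. -/
lemma SuperlinearOn.exists_linear_of_additive {r k : ℕ} {S : AddSubmonoid (Fin r → ℕ)}
    {F : (Fin r → ℝ) → ℝ} (hF : SuperlinearOn F (natCone (S : Set (Fin r → ℕ))))
    {u : Fin k → Fin r → ℕ} (hu : ∀ i, u i ∈ S)
    (hadd : ∀ s ∈ S, natToReal s ∈ natCone (Set.range u) →
      ∀ t ∈ S, natToReal t ∈ natCone (Set.range u) →
        F (natToReal (s + t)) = F (natToReal s) + F (natToReal t)) :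
    ∃ ℓ : (Fin r → ℝ) →ₗ[ℝ] ℝ, ∀ x ∈ natCone (Set.range u), F x = ℓ x := by
  have huK : ∀ i, natToReal (u i) ∈ natCone (S : Set (Fin r → ℕ)) := fun i =>
    natToReal_mem_natCone (hu i)
  have huC : ∀ i, natToReal (u i) ∈ natCone (Set.range u) := fun i =>
    natToReal_mem_natCone ⟨i, rfl⟩
  have h0 : F (natToReal 0) = 0 := by
    have : natToReal (0 : Fin r → ℕ) = 0 := map_zero (natToRealHom r)
    rw [this]
    simpa using hF.map_smul (Submodule.zero_mem _) le_rfl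
  have hnat : ∀ (n : Fin k → ℕ) (t : Finset (Fin k)),
      F (natToReal (∑ i ∈ t, n i • u i)) = ∑ i ∈ t, n i * F (natToReal (u i)) := by
    intro n t
    classical
    induction t using Finset.induction_on with
    | empty => simpa using h0
    | insert i t hi ih =>
      rw [Finset.sum_insert hi, Finset.sum_insert hi, hadd, ih, natToReal_nsmul,
        hF.map_smul (huK i) (Nat.cast_nonneg _)]
      · exact S.nsmul_mem (hu i) _
      · rw [natToReal_nsmul]
        exact smul_mem_of_nonneg _ (huC i) (Nat.cast_nonneg _)
      · exact sum_mem fun j _ => S.nsmul_mem (hu j) _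
      · rw [natToReal_sum_nsmul]
        exact sum_mem fun j _ => smul_mem_of_nonneg _ (huC j) (Nat.cast_nonneg _)
  have hreal : ∀ c : Fin k → ℝ, (∀ i, 0 ≤ c i) →
      F (∑ i, c i • natToReal (u i)) = ∑ i, c i * F (natToReal (u i)) := by
    intro c hc
    refine le_antisymm ?_ (hF.sum_le _ hc huK)
    have hnn : ∀ i, 0 ≤ (⌈c i⌉₊ : ℝ) - c i := fun i => sub_nonneg.2 (Nat.le_ceil _)
    have h1 := hF.sum_le Finset.univ hnn huK
    have h2 := hF.add_le
      (sum_mem fun i (_ : i ∈ Finset.univ) => smul_mem_of_nonneg _ (huK i) (hc i))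
      (sum_mem fun i (_ : i ∈ Finset.univ) => smul_mem_of_nonneg _ (huK i) (hnn i))
    rw [← Finset.sum_add_distrib] at h2
    simp only [← add_smul, add_sub_cancel] at h2
    rw [← natToReal_sum_nsmul, hnat] at h2
    simp only [sub_mul, Finset.sum_sub_distrib] at h1
    linarith
  let T := Fintype.linearCombination ℝ fun i => natToReal (u i)
  let L := Fintype.linearCombination ℝ fun i => F (natToReal (u i))
  have hT : ∀ c, T c = ∑ i, c i • natToReal (u i) := fun c => Fintype.linearCombination_apply ..
  have hL : ∀ c, L c = ∑ i, c i * F (natToReal (u i)) := fun c =>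
    Fintype.linearCombination_apply ..
  have hLT : L ∈ LinearMap.range T.dualMap := by
    rw [LinearMap.range_dualMap_eq_dualAnnihilator_ker, Submodule.mem_dualAnnihilator]
    intro a ha
    have hsplit : a = a⁺ - a⁻ := (posPart_sub_negPart a).symm
    rw [LinearMap.mem_ker, hsplit, map_sub, sub_eq_zero, hT, hT] at ha
    rw [hsplit, map_sub, sub_eq_zero, hL, hL, ← hreal _ (posPart_nonneg a),
      ← hreal _ (negPart_nonneg a), ha]
  obtain ⟨ℓ, hℓ⟩ := hLT
  refine ⟨ℓ, fun x hx => ?_⟩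
  obtain ⟨c, hc, rfl⟩ := (mem_natCone_range u x).1 hx
  rw [hreal c hc, ← hL, ← hT, ← hℓ]
  rfl

/-- **Existence and uniqueness of the straightening `f ♯` of a superadditive function.**
Let `S ⊆ ℕʳ` be a finitely generated submonoid and `f : S → ℝ` superadditive such that for
every `s ∈ S` the restriction of `f` to `ℕ s` is additive up to truncation. Then there is
a unique superlinear function `f ♯ : S_ℝ → ℝ` such that for every `s ∈ S` there exists
`λₛ ∈ ℤ_{>0}` with `f (λₛ s) = f ♯ (λₛ s)`. Furthermore, for every rational polyhedral
cone `C ⊆ S_ℝ`, the restriction of `f` to `C ∩ S` is additive up to truncation if and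
only if the restriction of `f ♯` to `C` is linear. -/
theorem straightening_exists_unique
    (r : ℕ) (S : AddSubmonoid (Fin r → ℕ)) (hSfg : S.FG)
    (f : (Fin r → ℕ) → ℝ)
    (hsuper : ∀ s ∈ S, ∀ t ∈ S, f s + f t ≤ f (s + t))
    (htrunc : ∀ s ∈ S, ∃ κ : ℕ, 0 < κ ∧ ∀ i : ℕ, f ((i * κ) • s) = i * f (κ • s)) :
    ∃ F : (Fin r → ℝ) → ℝ,
      (SuperlinearOn F (natConeHull (S : Set (Fin r → ℕ))) ∧
        (∀ s ∈ S, ∃ l : ℕ, 0 < l ∧ f (l • s) = F (natToReal (l • s)))) ∧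
      (∀ G : (Fin r → ℝ) → ℝ,
        (SuperlinearOn G (natConeHull (S : Set (Fin r → ℕ))) ∧
          (∀ s ∈ S, ∃ l : ℕ, 0 < l ∧ f (l • s) = G (natToReal (l • s)))) →
        ∀ x ∈ natConeHull (S : Set (Fin r → ℕ)), G x = F x) ∧
      (∀ C : Set (Fin r → ℝ), IsRationalPolyhedralCone C →
        C ⊆ natConeHull (S : Set (Fin r → ℕ)) →
        ((∃ κ : ℕ, 0 < κ ∧ ∀ s ∈ S, natToReal s ∈ C → ∀ t ∈ S, natToReal t ∈ C →
            f (κ • s + κ • t) = f (κ • s) + f (κ • t)) ↔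
          (∃ ℓ : (Fin r → ℝ) →ₗ[ℝ] ℝ, ∀ x ∈ C, F x = ℓ x))) := by
  rw [← coe_natCone]
  obtain ⟨g, hadd, hsmul, hfg, hg⟩ := exists_homogenization S f hsuper htrunc
  obtain ⟨F, hF, hFg⟩ := exists_superlinearOn_natCone S g hadd hsmul
  refine ⟨F, ⟨hF, fun s hs => ?_⟩, fun G ⟨hG, hGf⟩ x hx => ?_, fun C hC hCS => ?_⟩
  · obtain ⟨l, hl, hfl⟩ := hg s hs
    refine ⟨l, hl, ?_⟩
    have := hfl 1
    rw [one_mul, Nat.cast_one, one_mul] at this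
    rw [this, hFg _ (S.nsmul_mem hs l), hsmul s hs]
  · have hGF : ∀ s ∈ S, G (natToReal s) = F (natToReal s) := by
      intro s hs
      obtain ⟨l, hl, hfl⟩ := hg s hs
      obtain ⟨m, hm, hfm⟩ := hGf _ (S.nsmul_mem hs l)
      rw [smul_smul, hfl, natToReal_nsmul,
        hG.map_smul (natToReal_mem_natCone hs) (Nat.cast_nonneg _), Nat.cast_mul] at hfm
      rw [hFg s hs]
      exact (mul_left_cancel₀ (by positivity) hfm).symm
    exact le_antisymm (hF.le_of_eqOn hG hGF hx)
      (hG.le_of_eqOn hF (fun s hs => (hGF s hs).symm) hx)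
  · rw [coe_natCone] at hCS
    obtain ⟨k, u, hu, rfl⟩ := hC.exists_eq_natCone hCS
    simp only [SetLike.mem_coe]
    constructor
    · rintro ⟨κ, hκ, h⟩
      refine hF.exists_linear_of_additive hu fun s hs hsC t ht htC => ?_
      rw [hFg _ (S.add_mem hs ht), hFg s hs, hFg t ht]
      obtain ⟨a, ha, hfa⟩ := hg s hs
      obtain ⟨b, hb, hfb⟩ := hg t ht
      obtain ⟨d, hd, hfd⟩ := hg _ (S.add_mem hs ht)
      have hmem : ∀ v, natToReal v ∈ natCone (Set.range u) →
          natToReal ((a * b * d) • v) ∈ natCone (Set.range u) := fun v hv => by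
        rw [natToReal_nsmul]
        exact smul_mem_of_nonneg _ hv (Nat.cast_nonneg _)
      have key := h _ (S.nsmul_mem hs (a * b * d)) (hmem s hsC) _
        (S.nsmul_mem ht (a * b * d)) (hmem t htC)
      rw [← smul_add, ← smul_add, smul_smul, smul_smul, smul_smul,
        show κ * (a * b * d) = κ * a * b * d by ring, hfd,
        show κ * a * b * d = κ * b * d * a by ring, hfa,
        show κ * b * d * a = κ * a * d * b by ring, hfb] at key
      have hpos : (0 : ℝ) < κ * a * b * d := by positivity
      refine mul_left_cancel₀ hpos.ne' ?_
      push_cast at key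
      linarith
    · rintro ⟨ℓ, hℓ⟩
      obtain ⟨H, hH⟩ := fg_inf_comap_natCone hSfg u
      have hHS : ∀ s ∈ H, s ∈ S ∧ natToReal s ∈ natCone (Set.range u) := fun s hs => by
        have : s ∈ AddSubmonoid.closure (H : Set (Fin r → ℕ)) :=
          AddSubmonoid.subset_closure (Finset.mem_coe.2 hs)
        rwa [hH] at this
      choose! κ hκ hfκ using hg
      have hgℓ : ∀ s ∈ S, natToReal s ∈ natCone (Set.range u) → g s = ℓ (natToReal s) :=
        fun s hs hsC => by rw [← hFg s hs, hℓ _ hsC]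
      have hκpos : 0 < ∏ s ∈ H, κ s := Finset.prod_pos fun s hs => hκ s (hHS s hs).1
      have hlow : ∀ s ∈ AddSubmonoid.closure (H : Set (Fin r → ℕ)),
          s ∈ S ∧ ((∏ s ∈ H, κ s : ℕ) : ℝ) * ℓ (natToReal s) ≤ f ((∏ s ∈ H, κ s) • s) := by
        intro s hs
        induction hs using AddSubmonoid.closure_induction with
        | mem s hs =>
          obtain ⟨hsS, hsC⟩ := hHS s hs
          refine ⟨hsS, ?_⟩
          rw [← Finset.prod_erase_mul _ _ (Finset.mem_coe.1 hs), hfκ s hsS, ← hgℓ s hsS hsC,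
            Nat.cast_mul]
        | zero =>
          have h0 := hfκ 0 S.zero_mem 0
          have h1 : natToReal (0 : Fin r → ℕ) = 0 := map_zero (natToRealHom r)
          refine ⟨S.zero_mem, ?_⟩
          rw [zero_mul, zero_smul, Nat.cast_zero, zero_mul, zero_mul] at h0
          rw [h1, map_zero, mul_zero, smul_zero, h0]
        | add s t _ _ hs ht =>
          refine ⟨S.add_mem hs.1 ht.1, ?_⟩
          have := hsuper _ (S.nsmul_mem hs.1 (∏ s ∈ H, κ s)) _ (S.nsmul_mem ht.1 (∏ s ∈ H, κ s))
          rw [smul_add, natToReal_add, map_add, mul_add]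
          linarith [hs.2, ht.2]
      have heq : ∀ s ∈ S, natToReal s ∈ natCone (Set.range u) →
          f ((∏ s ∈ H, κ s) • s) = ((∏ s ∈ H, κ s : ℕ) : ℝ) * ℓ (natToReal s) := by
        intro s hs hsC
        refine le_antisymm ?_ (hlow s (hH ▸ ⟨hs, hsC⟩)).2
        rw [← hgℓ s hs hsC, ← hsmul s hs]
        exact hfg _ (S.nsmul_mem hs _)
      refine ⟨∏ s ∈ H, κ s, hκpos, fun s hs hsC t ht htC => ?_⟩
      rw [← smul_add, heq s hs hsC, heq t ht htC,
        heq _ (S.add_mem hs ht) (by rw [natToReal_add]; exact add_mem hsC htC),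
        natToReal_add, map_add, mul_add]
end

section
/- Let x ∈ ℝ^n, let W be the smallest rational affine subspace of ℝ^n containing x, and fix a positive integer k and a real number ε > 0. Then there are finitely many tuples (x_i, k, k_i, r_i) ∈ (W ∩ ℚ^n) × ℤ_{>0}² × ℝ_{>0}, i = 1, …, p, which uniformly approximate x with error ε; that is, k_i x_i / k ∈ ℤ^n for every i, ‖x − x_i‖ < ε/k_i for every i, and x = Σ r_i x_i with Σ r_i = 1. -/
/-- The natural embedding `ℚⁿ → ℝⁿ`. -/
def ratToReal {n : ℕ} (q : Fin n → ℚ) : Fin n → ℝ := fun i => (q i : ℝ)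

/-- An affine subspace of `ℝⁿ` is rational if it is the affine span of a set of rational
points. -/
def IsRationalAffineSubspace {n : ℕ} (W : AffineSubspace ℝ (Fin n → ℝ)) : Prop :=
  ∃ s : Set (Fin n → ℚ), W = affineSpan ℝ (ratToReal '' s)

/-- Small vectors in the span of `A` are combinations of a fixed finite subset of `A` with small
coefficients. -/
lemma exists_finset_small_coeffs {E : Type*} [NormedAddCommGroup E] [NormedSpace ℝ E]
    [FiniteDimensional ℝ E] (A : Set E) :
    ∃ F : Finset E, (F : Set E) ⊆ A ∧ Submodule.span ℝ (F : Set E) = Submodule.span ℝ A ∧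
      ∀ r > 0, ∃ δ > 0, ∀ v ∈ Submodule.span ℝ A, ‖v‖ < δ →
        ∃ f : F → ℝ, (∀ a, |f a| < r) ∧ v = ∑ a, f a • (a : E) := by
  obtain ⟨b, hbA, hspan, hli⟩ := exists_linearIndependent ℝ A
  lift b to Finset E using hli.setFinite
  refine ⟨b, hbA, hspan, fun r hr => ?_⟩
  have hli' : LinearIndependent ℝ (fun a : b => (a : E)) := hli
  have hrange : Set.range (fun a : b => (a : E)) = b := Subtype.range_coe
  let B := Module.Basis.span hli'
  have hcont : Continuous B.equivFun :=
    LinearMap.continuous_of_finiteDimensional B.equivFun.toLinearMap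
  obtain ⟨δ, hδ, h⟩ := Metric.continuousAt_iff.mp (hcont.continuousAt (x := 0)) r hr
  refine ⟨δ, hδ, fun v hv hvδ => ?_⟩
  have hv' : v ∈ Submodule.span ℝ (Set.range (fun a : b => (a : E))) := by
    rw [hrange, hspan]; exact hv
  have hsmall := h (x := ⟨v, hv'⟩) (by simpa [dist_zero_right] using hvδ)
  rw [map_zero, dist_zero_right, pi_norm_lt_iff hr] at hsmall
  refine ⟨B.equivFun ⟨v, hv'⟩, hsmall, ?_⟩
  have hsum := congrArg Subtype.val (B.sum_equivFun ⟨v, hv'⟩)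
  simpa [B, Module.Basis.span_apply] using hsum.symm

/-- Simultaneous Dirichlet approximation by integer vectors preserving the coordinate sum. -/
lemma exists_int_vector_near_multiple {ι : Type*} [Fintype ι] (t : ι → ℝ) (ht : ∑ i, t i = 1)
    (η : ℝ) (hη : 0 < η) (N : ℕ) :
    ∃ s : ι → ℤ, (N : ℤ) < ∑ i, s i ∧ ∀ i, |(s i : ℝ) - (∑ i, s i : ℤ) * t i| < η := by
  obtain ⟨η', hη', hle, hcard⟩ : ∃ η' > 0, η' ≤ η ∧ Fintype.card ι * η' < 1 := by
    refine ⟨min η (1 / (Fintype.card ι + 1)), by positivity, min_le_left _ _, ?_⟩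
    calc (Fintype.card ι : ℝ) * min η (1 / (Fintype.card ι + 1))
        ≤ Fintype.card ι * (1 / (Fintype.card ι + 1)) := by gcongr; exact min_le_right _ _
      _ < 1 := by rw [mul_one_div, div_lt_one (by positivity)]; linarith
  let u : ℕ → ι → ℝ := fun m i => Int.fract (m * t i)
  have hu : ∀ m, u m ∈ Set.Icc (0 : ι → ℝ) 1 := fun m =>
    ⟨fun i => Int.fract_nonneg _, fun i => (Int.fract_lt_one _).le⟩
  obtain ⟨a, -, φ, hφ, hlim⟩ := isCompact_Icc.tendsto_subseq hu
  obtain ⟨K, hK⟩ := Metric.cauchySeq_iff.mp hlim.cauchySeq η' hη'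
  set m₁ := φ K with hm₁
  set m₂ := φ (K + m₁ + N + 1) with hm₂
  have hlt : m₁ + N < m₂ := by
    have := hφ.id_le (K + m₁ + N + 1)
    simp only [id] at this
    omega
  have hdist := hK (K + m₁ + N + 1) (by omega) K le_rfl
  rw [dist_pi_lt_iff hη'] at hdist
  have happrox : ∀ i, |((⌊m₂ * t i⌋ - ⌊m₁ * t i⌋ : ℤ) : ℝ) - ((m₂ : ℝ) - m₁) * t i| < η' := by
    intro i
    have := hdist i
    simp only [Function.comp, u, ← hm₁, ← hm₂, Real.dist_eq, Int.fract] at this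
    rw [abs_sub_comm] at this
    convert this using 2
    push_cast
    ring
  have hsum : ∑ i, (⌊m₂ * t i⌋ - ⌊m₁ * t i⌋) = (m₂ : ℤ) - m₁ := by
    rw [← sub_eq_zero, ← Int.abs_lt_one_iff]
    have : |((∑ i, (⌊m₂ * t i⌋ - ⌊m₁ * t i⌋) - ((m₂ : ℤ) - m₁) : ℤ) : ℝ)| < 1 := by
      calc |((∑ i, (⌊m₂ * t i⌋ - ⌊m₁ * t i⌋) - ((m₂ : ℤ) - m₁) : ℤ) : ℝ)|
          = |∑ i, (((⌊m₂ * t i⌋ - ⌊m₁ * t i⌋ : ℤ) : ℝ) - ((m₂ : ℝ) - m₁) * t i)| := by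
            rw [Finset.sum_sub_distrib (f := fun i => ((⌊m₂ * t i⌋ - ⌊m₁ * t i⌋ : ℤ) : ℝ)), ← Finset.mul_sum, ht]
            push_cast
            rw [mul_one]
        _ ≤ ∑ i, |((⌊m₂ * t i⌋ - ⌊m₁ * t i⌋ : ℤ) : ℝ) - ((m₂ : ℝ) - m₁) * t i| :=
            Finset.abs_sum_le_sum_abs _ _
        _ ≤ ∑ _i : ι, η' := Finset.sum_le_sum fun i _ => (happrox i).le
        _ < 1 := by simpa using hcard
    exact_mod_cast this
  refine ⟨fun i => ⌊m₂ * t i⌋ - ⌊m₁ * t i⌋, by rw [hsum]; omega, fun i => ?_⟩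
  rw [hsum]
  simpa using (happrox i).trans_le hle

/-- A point `t` with coordinate sum `1` is a positive combination of integer vectors with positive
coordinate sum that are close to multiples of `t`. -/
lemma exists_positive_combination_int_vectors {ι : Type*} [Fintype ι] (t : ι → ℝ)
    (ht : ∑ i, t i = 1) (η : ℝ) (hη : 0 < η) :
    ∃ (p : ℕ) (s : Fin p → ι → ℤ) (c : Fin p → ℝ), (∀ j, 0 < c j) ∧ (∀ j, 0 < ∑ i, s j i) ∧
      (∀ j i, |(s j i : ℝ) - (∑ i, s j i : ℤ) * t i| < η) ∧
      ∀ i, t i = ∑ j, c j * s j i := by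
  classical
  let A : Set (ι → ℝ) := {v | ∃ s : ι → ℤ, 0 < ∑ i, s i ∧
    (∀ i, |(s i : ℝ) - (∑ i, s i : ℤ) * t i| < η / 2) ∧ v = fun i => (s i : ℝ)}
  have ht_mem : t ∈ Submodule.span ℝ A := by
    rw [← SetLike.mem_coe, ← (Submodule.closed_of_finiteDimensional _).closure_eq,
      Metric.mem_closure_iff]
    intro δ hδ
    obtain ⟨s, hs, happrox⟩ :=
      exists_int_vector_near_multiple t ht (min (η / 2) δ) (by positivity) 0
    have hs1 : (1 : ℝ) ≤ (∑ i, s i : ℤ) := by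
      exact_mod_cast hs
    refine ⟨((∑ i, s i : ℤ) : ℝ)⁻¹ • (fun i => (s i : ℝ)), Submodule.smul_mem _ _
      (Submodule.subset_span ⟨s, by simpa using hs,
        fun i => (happrox i).trans_le (min_le_left _ _), rfl⟩), ?_⟩
    rw [dist_pi_lt_iff hδ]
    intro i
    have h := (happrox i).trans_le (min_le_right _ _)
    generalize ((∑ i, s i : ℤ) : ℝ) = M at *
    have hM : 0 < M := by linarith
    rw [Real.dist_eq, abs_sub_comm, Pi.smul_apply, smul_eq_mul]
    have heq : M⁻¹ * (s i : ℝ) - t i = M⁻¹ * ((s i : ℝ) - M * t i) := by field_simp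
    rw [heq, abs_mul, abs_of_pos (inv_pos.mpr hM)]
    calc M⁻¹ * |(s i : ℝ) - M * t i| ≤ 1 * |(s i : ℝ) - M * t i| := by
          gcongr; exact inv_le_one_of_one_le₀ hs1
      _ < δ := by rwa [one_mul]
  obtain ⟨F, hFA, hspan, hsmall⟩ := exists_finset_small_coeffs A
  have hFne : F.Nonempty := by
    rw [Finset.nonempty_iff_ne_empty]
    rintro rfl
    rw [← hspan] at ht_mem
    simp only [Finset.coe_empty, Submodule.span_empty, Submodule.mem_bot] at ht_mem
    simp [ht_mem] at ht
  have hd : (0 : ℝ) < F.card := by exact_mod_cast hFne.card_pos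
  obtain ⟨δ, hδ, hcoeff⟩ := hsmall (1 / F.card) (by positivity)
  choose σ hσpos hσapprox hσ using fun a : F => hFA a.2
  obtain ⟨l, hl, hlapprox⟩ := exists_int_vector_near_multiple t ht (min (η / 2) δ) (by positivity)
    (∑ a : F, (∑ i, σ a i).toNat)
  have hlσ : ∀ a : F, ∑ i, σ a i < ∑ i, l i := fun a => by
    have := Finset.single_le_sum (f := fun a : F => (∑ i, σ a i).toNat)
      (fun _ _ => Nat.zero_le _) (Finset.mem_univ a)
    omega
  have hlpos : 0 < ∑ i, l i := by
    obtain ⟨a, ha⟩ := hFne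
    exact (hσpos ⟨a, ha⟩).trans (hlσ ⟨a, ha⟩)
  have hlA : (fun i => (l i : ℝ)) ∈ A :=
    ⟨l, hlpos, fun i => (hlapprox i).trans_le (min_le_left _ _), rfl⟩
  have hM : (0 : ℝ) < (∑ i, l i : ℤ) := by exact_mod_cast hlpos
  obtain ⟨f, hf, hfsum⟩ := hcoeff ((fun i => (l i : ℝ)) - ((∑ i, l i : ℤ) : ℝ) • t)
    (Submodule.sub_mem _ (Submodule.subset_span hlA) (Submodule.smul_mem _ _ ht_mem))
    ((pi_norm_lt_iff hδ).mpr fun i => (hlapprox i).trans_le (min_le_right _ _))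
  let s : F ⊕ F → ι → ℤ := Sum.elim σ (fun a => l - σ a)
  let c : F ⊕ F → ℝ := Sum.elim (fun a => (1 / F.card - f a) / (∑ i, l i : ℤ))
    (fun _ => 1 / F.card / (∑ i, l i : ℤ))
  let e := (Fintype.equivFin (F ⊕ F)).symm
  refine ⟨_, fun j => s (e j), fun j => c (e j), fun j => ?_, fun j => ?_, fun j => ?_,
    fun i => ?_⟩
  · change 0 < c (e j)
    rcases e j with a | a
    · exact div_pos (sub_pos.mpr (abs_lt.mp (hf a)).2) hM
    · exact div_pos (by positivity) hM
  · change 0 < ∑ i, s (e j) i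
    rcases e j with a | a
    · exact hσpos a
    · simpa [s] using hlσ a
  · change ∀ i, |(s (e j) i : ℝ) - (∑ i, s (e j) i : ℤ) * t i| < η
    rcases e j with a | a
    · exact fun i => (hσapprox a i).trans (by linarith)
    · intro i
      have h₁ := (hlapprox i).trans_le (min_le_left _ _)
      have h₂ := hσapprox a i
      simp only [s, Sum.elim_inr, Pi.sub_apply, Finset.sum_sub_distrib, Int.cast_sub]
      rw [abs_lt] at h₁ h₂ ⊢
      constructor <;> linarith [h₁.1, h₁.2, h₂.1, h₂.2]
  · rw [e.sum_comp (fun j => c j * (s j i : ℝ)), Fintype.sum_sum_type]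
    simp only [s, c, Sum.elim_inl, Sum.elim_inr, Pi.sub_apply, Int.cast_sub]
    have hi := congrFun hfsum i
    simp only [Pi.sub_apply, Pi.smul_apply, smul_eq_mul, Finset.sum_apply] at hi
    have hi' : (l i : ℝ) - (∑ i, l i : ℤ) * t i = ∑ a : F, f a * (σ a i : ℝ) := by
      rw [hi]
      exact Finset.sum_congr rfl fun a _ => by rw [congrFun (hσ a) i]
    generalize ((∑ i, l i : ℤ) : ℝ) = M at *
    rw [← Finset.sum_add_distrib]
    calc t i = ((l i : ℝ) - ∑ a : F, f a * (σ a i : ℝ)) / M := by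
          rw [← hi']; field_simp; ring
      _ = ∑ a : F, ((1 / F.card * (l i : ℝ) - f a * (σ a i : ℝ)) / M) := by
          rw [← Finset.sum_div, Finset.sum_sub_distrib]
          congr 2
          simp only [Finset.sum_const, Finset.card_univ, Fintype.card_coe, nsmul_eq_mul]
          field_simp
      _ = _ := Finset.sum_congr rfl fun a _ => by ring

/-- Finitely many rational vectors can be scaled by one positive integer into `k ℤⁿ`. -/
lemma exists_nat_mul_eq_mul_int {κ : Type*} [Fintype κ] (q : κ → ℚ) (k : ℕ) (hk : 0 < k) :
    ∃ N : ℕ, 0 < N ∧ ∀ j, ∃ z : ℤ, (N : ℚ) * q j = k * z := by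
  classical
  refine ⟨k * ∏ j, (q j).den, Nat.mul_pos hk (Finset.prod_pos fun j _ => (q j).den_pos),
    fun j => ⟨(∏ i ∈ Finset.univ.erase j, ((q i).den : ℤ)) * (q j).num, ?_⟩⟩
  rw [← Finset.mul_prod_erase _ _ (Finset.mem_univ j)]
  push_cast
  linear_combination (k : ℚ) * (∏ i ∈ Finset.univ.erase j, ((q i).den : ℚ)) * (q j).mul_den_eq_num

/-- **Uniform Diophantine approximation in the smallest rational affine subspace.**
Let `x ∈ ℝⁿ`, let `W` be the smallest rational affine subspace containing `x`, and fix a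
positive integer `k` and a real `ε > 0`. Then there are finitely many tuples
`(xᵢ, k, kᵢ, rᵢ) ∈ (W ∩ ℚⁿ) × ℤ_{>0}² × ℝ_{>0}` which uniformly approximate `x` with
error `ε`: `kᵢ xᵢ / k` is integral, `‖x − xᵢ‖ < ε / kᵢ` (sup-norm), `x = Σ rᵢ xᵢ` and
`Σ rᵢ = 1`. -/
theorem uniform_approximation_in_smallest_rational_affine
    (n : ℕ) (x : Fin n → ℝ) (W : AffineSubspace ℝ (Fin n → ℝ))
    (hW : IsRationalAffineSubspace W) (hxW : x ∈ W)
    (hWmin : ∀ W' : AffineSubspace ℝ (Fin n → ℝ),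
      IsRationalAffineSubspace W' → x ∈ W' → W ≤ W')
    (k : ℕ) (hk : 0 < k) (ε : ℝ) (hε : 0 < ε) :
    ∃ (p : ℕ) (y : Fin p → Fin n → ℚ) (ki : Fin p → ℕ) (ri : Fin p → ℝ),
      (∀ i, ratToReal (y i) ∈ W) ∧
      (∀ i, 0 < ki i) ∧
      (∀ i, 0 < ri i) ∧
      (∀ i, ∀ j, ∃ z : ℤ, (ki i : ℚ) * y i j = (k : ℚ) * z) ∧
      (∀ i, ‖x - ratToReal (y i)‖ < ε / ki i) ∧
      x = ∑ i, ri i • ratToReal (y i) ∧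
      ∑ i, ri i = 1 := by
  obtain ⟨S, rfl⟩ := hW
  obtain ⟨fs, t, ht, hS, hx⟩ : ∃ (fs : Finset (Fin n → ℚ)) (t : fs → ℝ), ∑ i, t i = 1 ∧
      (∀ i : fs, (i : Fin n → ℚ) ∈ S) ∧ x = ∑ i, t i • ratToReal (i : Fin n → ℚ) := by
    obtain ⟨fs, w, hfs, hw, hx⟩ := eq_affineCombination_of_mem_affineSpan_image hxW
    refine ⟨fs, fun i => w i, by rw [Finset.sum_coe_sort fs w, hw], fun i => hfs i.2, ?_⟩
    rw [hx, Finset.affineCombination_eq_linear_combination _ _ _ hw]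
    exact (Finset.sum_coe_sort fs (fun i => w i • ratToReal i)).symm
  obtain ⟨N, hN, hNz⟩ := exists_nat_mul_eq_mul_int
    (fun a : fs × Fin n => (a.1 : Fin n → ℚ) a.2) k hk
  have hN' : (0 : ℝ) < N := by exact_mod_cast hN
  set C : ℝ := ∑ i : fs, ‖ratToReal (i : Fin n → ℚ)‖ with hC
  have hC0 : 0 ≤ C := Finset.sum_nonneg fun i _ => norm_nonneg _
  set η : ℝ := ε / (N * (C + 1)) with hη
  obtain ⟨p, s, c, hc, hs, happrox, hsum⟩ :=
    exists_positive_combination_int_vectors t ht η (by positivity)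
  set M : Fin p → ℤ := fun j => ∑ i, s j i with hMdef
  have hM : ∀ j, (0 : ℝ) < M j := fun j => by exact_mod_cast hs j
  have hMq : ∀ j, (M j : ℚ) ≠ 0 := fun j => by exact_mod_cast (hs j).ne'
  have hMnat : ∀ j, (((M j).toNat : ℕ) : ℤ) = M j := fun j => Int.toNat_of_nonneg (hs j).le
  have hMnatR : ∀ j, (((M j).toNat : ℕ) : ℝ) = M j := fun j => by exact_mod_cast hMnat j
  have hMnatQ : ∀ j, (((M j).toNat : ℕ) : ℚ) = M j := fun j => by exact_mod_cast hMnat j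
  let y : Fin p → Fin n → ℚ := fun j => ∑ i : fs, ((s j i : ℚ) / M j) • (i : Fin n → ℚ)
  have hy : ∀ j, ratToReal (y j) =
      ∑ i : fs, ((s j i : ℝ) / M j) • ratToReal (i : Fin n → ℚ) := by
    intro j
    ext l
    simp [y, ratToReal, Finset.sum_apply]
  refine ⟨p, y, fun j => N * (M j).toNat, fun j => c j * M j, fun j => ?_, fun j => ?_,
    fun j => mul_pos (hc j) (hM j), fun j l => ?_, fun j => ?_, ?_, ?_⟩
  · have hw : ∑ i : fs, (s j i : ℝ) / M j = 1 := by
      rw [← Finset.sum_div, div_eq_one_iff_eq (hM j).ne']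
      simp [hMdef]
    rw [hy, ← Finset.affineCombination_eq_linear_combination _ _ _ hw]
    refine affineSpan_mono ℝ ?_ (affineCombination_mem_affineSpan hw
      (fun i : fs => ratToReal (i : Fin n → ℚ)))
    rintro _ ⟨i, rfl⟩
    exact ⟨i, hS i, rfl⟩
  · have : 0 < M j := hs j
    exact Nat.mul_pos hN (by omega)
  · choose z hz using hNz
    refine ⟨∑ i : fs, s j i * z (i, l), ?_⟩
    simp only [y, Finset.sum_apply, Pi.smul_apply, smul_eq_mul, Nat.cast_mul, hMnatQ,
      Int.cast_sum, Int.cast_mul, Finset.mul_sum]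
    refine Finset.sum_congr rfl fun i _ => ?_
    have hzi : (N : ℚ) * (i : Fin n → ℚ) l = k * z (i, l) := hz (i, l)
    have := hMq j
    field_simp
    linear_combination (s j i : ℚ) * hzi
  · have hdiff : x - ratToReal (y j) =
        ∑ i : fs, (t i - (s j i : ℝ) / M j) • ratToReal (i : Fin n → ℚ) := by
      rw [hy, hx, ← Finset.sum_sub_distrib]
      exact Finset.sum_congr rfl fun i _ => (sub_smul _ _ _).symm
    have hcoef : ∀ i : fs, |t i - (s j i : ℝ) / M j| ≤ η / M j := by
      intro i
      have hMj := hM j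
      have heq : t i - (s j i : ℝ) / M j = -(((s j i : ℝ) - M j * t i) / M j) := by
        field_simp
        ring
      rw [heq, abs_neg, abs_div, abs_of_pos hMj]
      exact div_le_div_of_nonneg_right (happrox j i).le hMj.le
    rw [hdiff, Nat.cast_mul, hMnatR]
    calc ‖∑ i : fs, (t i - (s j i : ℝ) / M j) • ratToReal (i : Fin n → ℚ)‖
        ≤ ∑ i : fs, η / M j * ‖ratToReal (i : Fin n → ℚ)‖ := by
          refine norm_sum_le_of_le _ fun i _ => ?_
          rw [norm_smul, Real.norm_eq_abs]
          exact mul_le_mul_of_nonneg_right (hcoef i) (norm_nonneg _)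
      _ = ε / (N * M j) * (C / (C + 1)) := by
          have := hM j
          rw [← Finset.mul_sum, ← hC, hη]
          field_simp
      _ < ε / (N * M j) := by
          have := hM j
          exact mul_lt_of_lt_one_right (by positivity)
            ((div_lt_one (by positivity)).mpr (by linarith))
  · simp only [hy, Finset.smul_sum, smul_smul]
    rw [Finset.sum_comm, hx]
    refine Finset.sum_congr rfl fun i _ => ?_
    rw [← Finset.sum_smul, hsum i]
    congr 1
    refine Finset.sum_congr rfl fun j _ => ?_
    have := hM j
    field_simp
  · calc ∑ j, c j * (M j : ℝ) = ∑ j, ∑ i : fs, c j * (s j i : ℝ) := by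
          refine Finset.sum_congr rfl fun j _ => ?_
          rw [← Finset.mul_sum]
          simp [hMdef]
      _ = ∑ i : fs, t i := by
          rw [Finset.sum_comm]
          exact Finset.sum_congr rfl fun i _ => (hsum i).symm
      _ = 1 := ht
end

section
/- Let x ∈ ℝ^n, let W be the smallest rational affine subspace of ℝ^n containing x, and fix a positive integer k. Then there exists ε₀ > 0 such that for all rational ε, η with 0 < ε, η < ε₀ the following holds: whenever x₁ ∈ ℚ^n and k₁ ∈ ℤ_{>0} satisfy k₁x₁/k ∈ ℤ^n and ‖x − x₁‖ < ε/k₁, there exist finitely many points x_i ∈ ℚ^n and positive integers k_i for i = 2, …, p, and positive reals r_i for i = 1, …, p, such that (x_i, k, k_i, r_i), i = 1, …, p, uniformly approximate x with error ε, such that x_i ∈ W for all i ≥ 3, and such that x = (k₁/(k₁+k₂))x₁ + (k₂/(k₁+k₂))x₂ + ξ with ‖ξ‖ < η/(k₁+k₂). -/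
/-- Simultaneous Dirichlet approximation: some arbitrarily large multiple of `x` is as close as
desired to the lattice `kℤⁿ`. -/
lemma exists_large_multiple_near_lattice {n : ℕ} (x : Fin n → ℝ) {k : ℕ} (hk : 0 < k)
    (B : ℕ) {τ : ℝ} (hτ : 0 < τ) :
    ∃ N : ℕ, B < N ∧ ∃ M : Fin n → ℤ,
      ‖(fun j => (k : ℝ) * M j - N * x j : Fin n → ℝ)‖ < τ := by
  have hk' : (0 : ℝ) < k := by exact_mod_cast hk
  let u : ℕ → Fin n → ℝ := fun m j => Int.fract ((m : ℝ) * (x j / k))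
  have hu : ∀ m, u m ∈ Set.Icc (0 : Fin n → ℝ) 1 := fun m =>
    ⟨fun j => Int.fract_nonneg _, fun j => (Int.fract_lt_one _).le⟩
  obtain ⟨a, -, φ, hφ, hlim⟩ := isCompact_Icc.tendsto_subseq hu
  obtain ⟨m, hm⟩ := Metric.cauchySeq_iff'.1 hlim.cauchySeq (τ / k) (by positivity)
  have hgrow : φ m + (B + 1) ≤ φ (B + 1 + m) := by
    have := hφ.add_le_nat (B + 1) m
    omega
  have hdist := hm (B + 1 + m) (by omega)
  refine ⟨φ (B + 1 + m) - φ m, by omega,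
    fun j => ⌊(φ (B + 1 + m) : ℝ) * (x j / k)⌋ - ⌊(φ m : ℝ) * (x j / k)⌋, ?_⟩
  have hrw : (fun j => (k : ℝ) * ((⌊(φ (B + 1 + m) : ℝ) * (x j / k)⌋ -
      ⌊(φ m : ℝ) * (x j / k)⌋ : ℤ) : ℝ) - ((φ (B + 1 + m) - φ m : ℕ) : ℝ) * x j : Fin n → ℝ) =
      (-(k : ℝ)) • (u (φ (B + 1 + m)) - u (φ m)) := by
    funext j
    have hle : φ m ≤ φ (B + 1 + m) := by omega
    simp only [u, Pi.smul_apply, Pi.sub_apply, smul_eq_mul, Int.fract]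
    push_cast [Nat.cast_sub hle]
    field_simp
    ring
  rw [hrw, norm_smul, norm_neg, Real.norm_of_nonneg hk'.le, ← dist_eq_norm]
  rw [lt_div_iff₀ hk'] at hdist
  simpa [mul_comm] using hdist

open scoped NNReal in
/-- If the negative of each element of `D` is a limit of elements of `D` and `D` spans the whole
space, then so does the convex cone generated by `D`. -/
lemma mem_span_nnreal_of_neg_mem_closure_of_span_eq_top {E : Type*} [NormedAddCommGroup E]
    [NormedSpace ℝ E] [FiniteDimensional ℝ E] {D : Set E} (hD : ∀ d ∈ D, -d ∈ closure D)
    (hspan : Submodule.span ℝ D = ⊤) (v : E) : v ∈ Submodule.span ℝ≥0 D := by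
  set C : Submodule ℝ≥0 E := Submodule.span ℝ≥0 D with hC
  have hsmul : ∀ (a : ℝ), 0 ≤ a → ∀ w ∈ C, a • w ∈ C := fun a ha w hw =>
    C.smul_mem ⟨a, ha⟩ hw
  have hDC : D ⊆ C := Submodule.subset_span
  have hconv : Convex ℝ (C : Set E) := fun a ha b hb s t hs ht _ =>
    C.add_mem (hsmul s hs a ha) (hsmul t ht b hb)
  have hclos_smul : ∀ (a : ℝ), 0 ≤ a → ∀ w ∈ closure (C : Set E), a • w ∈ closure (C : Set E) :=
    fun a ha w hw => map_mem_closure (continuous_const_smul a) hw (fun y hy => hsmul a ha y hy)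
  have hclos_add : ∀ v ∈ closure (C : Set E), ∀ w ∈ closure (C : Set E),
      v + w ∈ closure (C : Set E) :=
    fun v hv w hw => map_mem_closure₂ continuous_add hv hw (fun a ha b hb => C.add_mem ha hb)
  have hclos : ∀ w : E, w ∈ closure (C : Set E) ∧ -w ∈ closure (C : Set E) := by
    intro w
    have hw : w ∈ Submodule.span ℝ D := hspan ▸ Submodule.mem_top
    induction hw using Submodule.span_induction with
    | mem d hd => exact ⟨subset_closure (hDC hd), closure_mono hDC (hD d hd)⟩
    | zero => simpa using subset_closure C.zero_mem
    | add v w _ _ hv hw =>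
      refine ⟨hclos_add _ hv.1 _ hw.1, ?_⟩
      rw [neg_add]
      exact hclos_add _ hv.2 _ hw.2
    | smul a w _ hw =>
      rcases le_total 0 a with ha | ha
      · exact ⟨hclos_smul a ha _ hw.1, by simpa using hclos_smul a ha _ hw.2⟩
      · exact ⟨by simpa using hclos_smul (-a) (by linarith) _ hw.2,
          by simpa using hclos_smul (-a) (by linarith) _ hw.1⟩
  have hint : (interior (C : Set E)).Nonempty := by
    rw [hconv.interior_nonempty_iff_affineSpan_eq_top,
      AffineSubspace.affineSpan_eq_top_iff_vectorSpan_eq_top_of_nonempty ℝ E E ⟨0, C.zero_mem⟩,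
      eq_top_iff, ← hspan, Submodule.span_le]
    intro d hd
    simpa using vsub_mem_vectorSpan ℝ (hDC hd) C.zero_mem
  have huniv : closure (C : Set E) = Set.univ := Set.eq_univ_of_forall fun w => (hclos w).1
  have heq := hconv.interior_closure_eq_interior_of_nonempty_interior hint
  rw [huniv, interior_univ] at heq
  exact interior_subset (heq ▸ Set.mem_univ v)

open scoped NNReal in
/-- If the negative of each element of `D` is a limit of elements of `D`, the convex cone spanned by
`D` contains the negatives of the elements of `D`. -/
lemma neg_mem_span_nnreal_of_neg_mem_closure {E : Type*} [NormedAddCommGroup E]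
    [NormedSpace ℝ E] [FiniteDimensional ℝ E] {D : Set E} (hD : ∀ d ∈ D, -d ∈ closure D)
    {d : E} (hd : d ∈ D) : -d ∈ Submodule.span ℝ≥0 D := by
  let V : Submodule ℝ E := Submodule.span ℝ D
  let D' : Set V := (↑) ⁻¹' D
  have himage : ((↑) : V → E) '' D' = D := by
    rw [Set.image_preimage_eq_inter_range, Subtype.range_coe]
    exact Set.inter_eq_left.2 Submodule.subset_span
  have hD' : ∀ e ∈ D', -e ∈ closure D' := by
    intro e he
    rw [closure_subtype, himage]
    exact hD e he
  have h := mem_span_nnreal_of_neg_mem_closure_of_span_eq_top hD'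
    (Submodule.span_span_coe_preimage) (-⟨d, Submodule.subset_span hd⟩ : V)
  have h' := Submodule.mem_map_of_mem (f := (V.subtype.restrictScalars ℝ≥0)) h
  rw [Submodule.map_span] at h'
  have himage' : (V.subtype.restrictScalars ℝ≥0) '' D' = D := himage
  rw [himage'] at h'
  exact h'

/-- `ratToReal` as a `ℚ`-linear map. -/
def ratToRealLinearMap (n : ℕ) : (Fin n → ℚ) →ₗ[ℚ] (Fin n → ℝ) where
  toFun := ratToReal
  map_add' a b := by funext j; simp [ratToReal]
  map_smul' c a := by funext j; simp [ratToReal, Rat.smul_def]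

/-- A rational point that belongs to the rational affine span of `s` belongs to its real affine
span. -/
lemma ratToReal_mem_affineSpan {n : ℕ} {s : Set (Fin n → ℚ)} {y : Fin n → ℚ}
    (hy : y ∈ affineSpan ℚ s) : ratToReal y ∈ affineSpan ℝ (ratToReal '' s) := by
  obtain ⟨p, hp⟩ : s.Nonempty := (affineSpan_nonempty ℚ).1 ⟨y, hy⟩
  have hyp : y - p ∈ vectorSpan ℚ s := by
    rw [← direction_affineSpan]
    exact AffineSubspace.vsub_mem_direction hy (subset_affineSpan ℚ s hp)
  have hle : vectorSpan ℚ s ≤ ((vectorSpan ℝ (ratToReal '' s)).restrictScalars ℚ).comap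
      (ratToRealLinearMap n) := by
    refine Submodule.span_le.2 ?_
    rintro _ ⟨a, ha, b, hb, rfl⟩
    change ratToRealLinearMap n (a - b) ∈ vectorSpan ℝ (ratToReal '' s)
    rw [map_sub]
    exact vsub_mem_vectorSpan ℝ (Set.mem_image_of_mem _ ha) (Set.mem_image_of_mem _ hb)
  have h : ratToRealLinearMap n (y - p) ∈ (affineSpan ℝ (ratToReal '' s)).direction := by
    rw [direction_affineSpan]
    exact hle hyp
  have hadd := AffineSubspace.vadd_mem_of_mem_direction h
    (subset_affineSpan ℝ _ (Set.mem_image_of_mem ratToReal hp))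
  rw [map_sub] at hadd
  simpa [ratToRealLinearMap] using hadd

/-- Finitely many rationals have a common denominator. -/
lemma exists_common_denominator {ι : Type*} [Finite ι] (q : ι → ℚ) :
    ∃ D : ℕ, 0 < D ∧ ∀ i, ∃ z : ℤ, (D : ℚ) * q i = z := by
  have := Fintype.ofFinite ι
  refine ⟨∏ i, (q i).den, Finset.prod_pos fun i _ => (q i).den_pos, fun i => ?_⟩
  obtain ⟨c, hc⟩ := Finset.dvd_prod_of_mem (fun i => (q i).den) (Finset.mem_univ i)
  refine ⟨c * (q i).num, ?_⟩
  rw [hc]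
  push_cast
  rw [mul_right_comm, Rat.den_mul_eq_num, mul_comm]

/-- Every subspace of `Kⁿ` is the kernel of a square matrix. -/
lemma exists_matrix_mulVec_eq_zero_iff {K : Type*} [Field K] {n : ℕ}
    (U : Submodule K (Fin n → K)) :
    ∃ A : Matrix (Fin n) (Fin n) K, ∀ v, A.mulVec v = 0 ↔ v ∈ U := by
  obtain ⟨U', hU'⟩ := U.exists_isCompl
  refine ⟨LinearMap.toMatrix' (U'.subtype ∘ₗ U'.projectionOnto U hU'.symm), fun v => ?_⟩
  rw [← Matrix.toLin'_apply, Matrix.toLin'_toMatrix', LinearMap.comp_apply,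
    Submodule.subtype_apply, Submodule.coe_eq_zero, ← LinearMap.mem_ker,
    Submodule.ker_projectionOnto]

/-- A rational affine subspace containing `x` contains all sufficiently good rational
approximations of `x`. -/
lemma IsRationalAffineSubspace.exists_forall_mem_of_norm_lt {n : ℕ} {x : Fin n → ℝ}
    {W : AffineSubspace ℝ (Fin n → ℝ)} (hW : IsRationalAffineSubspace W) (hxW : x ∈ W) :
    ∃ δ : ℝ, 0 < δ ∧ ∀ (K : ℕ) (y : Fin n → ℚ), 0 < K → (∀ j, ∃ z : ℤ, (K : ℚ) * y j = z) →
      ‖(K : ℝ) • (ratToReal y - x)‖ < δ → ratToReal y ∈ W := by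
  obtain ⟨s, rfl⟩ := hW
  obtain ⟨p, hp⟩ : s.Nonempty := by
    simpa using (affineSpan_nonempty ℝ (s := ratToReal '' s)).1 ⟨x, hxW⟩
  obtain ⟨A, hA⟩ := exists_matrix_mulVec_eq_zero_iff (vectorSpan ℚ s)
  let g : (Fin n → ℝ) →ₗ[ℝ] (Fin n → ℝ) := (A.map (Rat.cast : ℚ → ℝ)).mulVecLin
  have hg : ∀ v : Fin n → ℚ, g (ratToReal v) = ratToReal (A.mulVec v) := by
    intro v
    funext i
    simp [g, ratToReal, Matrix.mulVec, dotProduct]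
  have hgx : g (x - ratToReal p) = 0 := by
    have hxp : x - ratToReal p ∈ vectorSpan ℝ (ratToReal '' s) := by
      rw [← direction_affineSpan]
      exact AffineSubspace.vsub_mem_direction hxW
        (subset_affineSpan ℝ _ (Set.mem_image_of_mem _ hp))
    have hle : vectorSpan ℝ (ratToReal '' s) ≤ LinearMap.ker g := by
      refine Submodule.span_le.2 ?_
      rintro _ ⟨_, ⟨a, ha, rfl⟩, _, ⟨b, hb, rfl⟩, rfl⟩
      change g (ratToReal a - ratToReal b) = 0
      have hab : A.mulVec (a - b) = 0 := (hA _).2 (vsub_mem_vectorSpan ℚ ha hb)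
      rw [Matrix.mulVec_sub, sub_eq_zero] at hab
      rw [map_sub, hg, hg, hab, sub_self]
    exact hle hxp
  obtain ⟨D₁, hD₁, hD₁A⟩ := exists_common_denominator fun ij : Fin n × Fin n => A ij.1 ij.2
  obtain ⟨D₂, hD₂, hD₂A⟩ := exists_common_denominator (A.mulVec p)
  let G := (((D₁ * D₂ : ℕ) : ℝ) • LinearMap.toContinuousLinearMap g)
  refine ⟨1 / (‖G‖ + 1), by positivity, fun K y hK hy hlt => ?_⟩
  have hG : ‖G ((K : ℝ) • (ratToReal y - x))‖ < 1 := by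
    rw [lt_div_iff₀ (by positivity)] at hlt
    have := G.le_opNorm ((K : ℝ) • (ratToReal y - x))
    nlinarith [norm_nonneg ((K : ℝ) • (ratToReal y - x)), norm_nonneg G]
  have hGeq : G ((K : ℝ) • (ratToReal y - x)) =
      ratToReal (((D₁ * D₂ * K : ℕ) : ℚ) • (A.mulVec y - A.mulVec p)) := by
    have hxp : g x = g (ratToReal p) := by rwa [map_sub, sub_eq_zero] at hgx
    have h1 : G ((K : ℝ) • (ratToReal y - x)) =
        ((D₁ * D₂ : ℕ) : ℝ) • (K : ℝ) • (g (ratToReal y) - g x) := by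
      simp only [G, map_smul, ← map_sub]
      rw [smul_comm]
      rfl
    rw [h1, hxp, hg, hg]
    funext i
    simp [ratToReal]
    ring
  choose M hM using hy
  have hint : ∀ i, ∃ z : ℤ, ((D₁ * D₂ * K : ℕ) : ℚ) * (A.mulVec y i - A.mulVec p i) = z := by
    intro i
    choose a ha using hD₁A
    obtain ⟨b, hb⟩ := hD₂A i
    refine ⟨D₂ * ∑ j, a (i, j) * M j - D₁ * K * b, ?_⟩
    push_cast
    rw [← hb, mul_sub]
    congr 1
    · simp only [Matrix.mulVec, dotProduct, Finset.mul_sum, ← hM, ← ha]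
      exact Finset.sum_congr rfl fun j _ => by ring
    · ring
  have hzero : A.mulVec (y - p) = 0 := by
    rw [Matrix.mulVec_sub]
    funext i
    obtain ⟨z, hz⟩ := hint i
    have hzlt := (norm_le_pi_norm _ i).trans_lt hG
    rw [hGeq] at hzlt
    simp only [ratToReal, Pi.smul_apply, Pi.sub_apply, smul_eq_mul, hz] at hzlt
    have hz0 : z = 0 := by
      rw [Real.norm_eq_abs, Rat.cast_intCast] at hzlt
      exact Int.abs_lt_one_iff.1 (by exact_mod_cast hzlt)
    rw [hz0, Int.cast_zero] at hz
    exact (mul_eq_zero.1 hz).resolve_left (by positivity)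
  refine ratToReal_mem_affineSpan ?_
  have hdir : y - p ∈ (affineSpan ℚ s).direction := by
    rw [direction_affineSpan]
    exact (hA _).1 hzero
  simpa using AffineSubspace.vadd_mem_of_mem_direction hdir (subset_affineSpan ℚ s hp)

/-- The scaled errors `K (y - x)` of the approximations of `x` by points `y` with
`K y ∈ kℤⁿ`, when smaller than `δ`. -/
def approximationErrors {n : ℕ} (x : Fin n → ℝ) (k : ℕ) (δ : ℝ) : Set (Fin n → ℝ) :=
  {d | ‖d‖ < δ ∧ ∃ (K : ℕ) (y : Fin n → ℚ), 0 < K ∧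
    (∀ j, ∃ z : ℤ, (K : ℚ) * y j = (k : ℚ) * z) ∧ d = (K : ℝ) • (ratToReal y - x)}

/-- The error of an approximation of `x` can be balanced, with positive weights, by the errors of
finitely many further approximations. -/
lemma exists_approximationErrors_balance {n : ℕ} (x : Fin n → ℝ) {k : ℕ} (hk : 0 < k) {δ : ℝ}
    {d : Fin n → ℝ} (hd : d ∈ approximationErrors x k δ) :
    ∃ (m : ℕ) (c : Fin m → ℝ) (e : Fin m → Fin n → ℝ),
      (∀ i, 0 < c i) ∧ (∀ i, e i ∈ approximationErrors x k δ) ∧ d + ∑ i, c i • e i = 0 := by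
  have hclos : ∀ d ∈ approximationErrors x k δ, -d ∈ closure (approximationErrors x k δ) := by
    rintro _ ⟨hdlt, K, y, hK, hy, rfl⟩
    refine Metric.mem_closure_iff.2 fun τ hτ => ?_
    set d := (K : ℝ) • (ratToReal y - x) with hd
    obtain ⟨N, hN, M, hNM⟩ := exists_large_multiple_near_lattice x hk K
      (lt_min hτ (sub_pos.2 hdlt))
    obtain ⟨hNMτ, hNMδ⟩ := lt_min_iff.1 hNM
    set w : Fin n → ℝ := fun j => (k : ℝ) * M j - N * x j with hw
    choose z hz using hy
    have hL : 0 < N - K := by omega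
    have hL' : ((N - K : ℕ) : ℚ) ≠ 0 := by positivity
    refine ⟨w - d, ⟨?_, N - K, fun j => k * (M j - z j) / (N - K : ℕ), hL, fun j => ?_, ?_⟩, ?_⟩
    · exact (norm_sub_le w d).trans_lt (by linarith)
    · refine ⟨M j - z j, ?_⟩
      push_cast
      field_simp
    · funext j
      have hL'' : ((N - K : ℕ) : ℝ) ≠ 0 := by positivity
      have hzj : (K : ℝ) * y j = k * z j := by exact_mod_cast hz j
      simp only [hw, hd, ratToReal, Pi.sub_apply, Pi.smul_apply, smul_eq_mul]
      push_cast
      rw [mul_sub, mul_sub, mul_div_cancel₀ _ hL'', hzj, Nat.cast_sub hN.le]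
      ring
    · rw [dist_eq_norm]
      have : -d - (w - d) = -w := by abel
      rwa [this, norm_neg]
  obtain ⟨c, hc, hsum⟩ :=
    Submodule.mem_span_set.1 (neg_mem_span_nnreal_of_neg_mem_closure hclos hd)
  refine ⟨c.support.card, fun i => c (c.support.equivFin.symm i),
    fun i => c.support.equivFin.symm i, fun i => ?_, fun i => hc (Subtype.coe_prop _), ?_⟩
  · exact NNReal.coe_pos.2 (pos_iff_ne_zero.2 (Finsupp.mem_support_iff.1 (Subtype.coe_prop _)))
  · rw [c.support.equivFin.symm.sum_comp
      (fun v : c.support => (c v : ℝ) • (v : Fin n → ℝ)),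
      Finset.sum_coe_sort c.support (fun v => (c v : ℝ) • v)]
    have hsum' : ∑ v ∈ c.support, (c v : ℝ) • v = -d := hsum
    rw [hsum', add_neg_cancel]

/-- **Refined Diophantine approximation starting from a given approximant.**
Let `x ∈ ℝⁿ`, let `W` be the smallest rational affine subspace containing `x`, and fix
`k ∈ ℤ_{>0}`. Then there is `ε₀ > 0` such that for all rational `0 < ε, η < ε₀`:
whenever `x₁ ∈ ℚⁿ`, `k₁ ∈ ℤ_{>0}` satisfy `k₁x₁/k ∈ ℤⁿ` and `‖x − x₁‖ < ε/k₁`, there are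
finitely many further points `xᵢ ∈ ℚⁿ`, integers `kᵢ > 0` and reals `rᵢ > 0` such that
the tuples `(xᵢ, k, kᵢ, rᵢ)` uniformly approximate `x` with error `ε`, with `xᵢ ∈ W` for
`i ≥ 3`, and `x = (k₁/(k₁+k₂))x₁ + (k₂/(k₁+k₂))x₂ + ξ` with `‖ξ‖ < η/(k₁+k₂)`. -/
theorem refined_uniform_approximation
    (n : ℕ) (x : Fin n → ℝ) (W : AffineSubspace ℝ (Fin n → ℝ))
    (hW : IsRationalAffineSubspace W) (hxW : x ∈ W)
    (hWmin : ∀ W' : AffineSubspace ℝ (Fin n → ℝ),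
      IsRationalAffineSubspace W' → x ∈ W' → W ≤ W')
    (k : ℕ) (hk : 0 < k) :
    ∃ ε₀ : ℝ, 0 < ε₀ ∧ ∀ ε η : ℚ, 0 < ε → (ε : ℝ) < ε₀ → 0 < η → (η : ℝ) < ε₀ →
      ∀ (x₁ : Fin n → ℚ) (k₁ : ℕ), 0 < k₁ →
        (∀ j, ∃ z : ℤ, (k₁ : ℚ) * x₁ j = (k : ℚ) * z) →
        ‖x - ratToReal x₁‖ < (ε : ℝ) / k₁ →
        ∃ (p : ℕ) (y : Fin p → Fin n → ℚ) (ki : Fin p → ℕ) (ri : Fin p → ℝ),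
          2 ≤ p ∧
          (∃ h : 0 < p, y ⟨0, h⟩ = x₁ ∧ ki ⟨0, h⟩ = k₁) ∧
          (∀ i, 0 < ki i) ∧
          (∀ i, 0 < ri i) ∧
          (∀ i, ∀ j, ∃ z : ℤ, (ki i : ℚ) * y i j = (k : ℚ) * z) ∧
          (∀ i, ‖x - ratToReal (y i)‖ < (ε : ℝ) / ki i) ∧
          x = ∑ i, ri i • ratToReal (y i) ∧
          (∑ i, ri i) = 1 ∧
          (∀ i : Fin p, 2 ≤ (i : ℕ) → ratToReal (y i) ∈ W) ∧
          (∀ h : 1 < p,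
            ‖x - ((k₁ : ℝ) / ((k₁ : ℝ) + (ki ⟨1, h⟩ : ℝ))) • ratToReal x₁
              - ((ki ⟨1, h⟩ : ℝ) / ((k₁ : ℝ) + (ki ⟨1, h⟩ : ℝ))) • ratToReal (y ⟨1, h⟩)‖
              < (η : ℝ) / ((k₁ : ℝ) + (ki ⟨1, h⟩ : ℝ))) := by
  refine ⟨1, one_pos, fun ε η hε _ hη _ x₁ k₁ hk₁ hx₁ hdist => ?_⟩
  have hk₁' : (0 : ℝ) < k₁ := by exact_mod_cast hk₁
  have hη' : (0 : ℝ) < η := by exact_mod_cast hη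
  obtain ⟨δ₀, hδ₀, hδW⟩ := hW.exists_forall_mem_of_norm_lt hxW
  set v : Fin n → ℝ := (k₁ : ℝ) • (x - ratToReal x₁) with hv
  have hvε : ‖v‖ < ε := by
    rw [lt_div_iff₀ hk₁'] at hdist
    rwa [hv, norm_smul, Real.norm_of_nonneg hk₁'.le, mul_comm]
  set δ : ℝ := min (η : ℝ) (min (ε - ‖v‖) δ₀) with hδ
  have hδη : δ ≤ η := min_le_left _ _
  have hδε : δ ≤ ε - ‖v‖ := (min_le_right _ _).trans (min_le_left _ _)
  have hδδ₀ : δ ≤ δ₀ := (min_le_right _ _).trans (min_le_right _ _)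
  have hδpos : 0 < δ := lt_min hη' (lt_min (sub_pos.2 hvε) hδ₀)
  obtain ⟨N, hN, M, hNM⟩ := exists_large_multiple_near_lattice x hk k₁ hδpos
  set d : Fin n → ℝ := fun j => (k : ℝ) * M j - N * x j with hd
  have hNpos : 0 < N := by omega
  have hN' : (0 : ℝ) < N := by exact_mod_cast hNpos
  have hdmem : d ∈ approximationErrors x k δ := by
    refine ⟨hNM, N, fun j => k * M j / N, hNpos, fun j => ⟨M j, by field_simp⟩, ?_⟩
    funext j
    simp only [hd, ratToReal, Pi.smul_apply, Pi.sub_apply, smul_eq_mul]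
    push_cast
    field_simp
  obtain ⟨m, c, e, hc, he, hsum⟩ := exists_approximationErrors_balance x hk hdmem
  choose heδ K y hK hy hey using he
  obtain ⟨k₂, rfl⟩ := Nat.exists_eq_add_of_lt hN
  set k₂' := k₂ + 1 with hk₂'
  have hNk : k₁ + k₂ + 1 = k₁ + k₂' := rfl
  rw [hNk] at hN' hd
  clear_value k₂'
  have hk₂pos : 0 < k₂' := by omega
  have hk₂ : (0 : ℝ) < k₂' := by exact_mod_cast hk₂pos
  push_cast at hN' hd
  set x₂ : Fin n → ℚ := fun j => (k * M j - k₁ * x₁ j) / k₂' with hx₂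
  have hx₂eq : ∀ j, (k₂' : ℝ) * ratToReal x₂ j = k * M j - k₁ * ratToReal x₁ j := by
    intro j
    simp only [hx₂, ratToReal]
    push_cast
    field_simp
  have hx₂err : (k₂' : ℝ) • (ratToReal x₂ - x) = d + v := by
    funext j
    have := hx₂eq j
    simp only [hd, hv, Pi.smul_apply, Pi.add_apply, Pi.sub_apply, smul_eq_mul]
    linarith
  have hclose : ∀ (κ : ℕ) (q : Fin n → ℚ), 0 < κ → ‖(κ : ℝ) • (ratToReal q - x)‖ < ε →
      ‖x - ratToReal q‖ < (ε : ℝ) / κ := by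
    intro κ q hκ h
    have hκ' : (0 : ℝ) < κ := by exact_mod_cast hκ
    rwa [norm_smul, Real.norm_of_nonneg hκ'.le, norm_sub_rev, mul_comm, ← lt_div_iff₀ hκ'] at h
  set T : ℝ := k₁ + k₂' + ∑ i, c i * K i with hT
  have hcK : ∀ i, 0 < c i * K i := fun i => mul_pos (hc i) (by exact_mod_cast hK i)
  have hTpos : 0 < T := add_pos_of_pos_of_nonneg hN' (Finset.sum_nonneg fun i _ => (hcK i).le)
  have hy' : ∀ i, ‖(K i : ℝ) • (ratToReal (y i) - x)‖ < δ := fun i => hey i ▸ heδ i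
  refine ⟨m + 2, Fin.cons x₁ (Fin.cons x₂ y), Fin.cons k₁ (Fin.cons k₂' K),
    Fin.cons (k₁ / T) (Fin.cons (k₂' / T) fun i => c i * K i / T), by omega,
    ⟨by omega, rfl, rfl⟩,
    Fin.forall_fin_succ.2 ⟨hk₁, Fin.forall_fin_succ.2 ⟨hk₂pos, hK⟩⟩,
    Fin.forall_fin_succ.2 ⟨div_pos hk₁' hTpos,
      Fin.forall_fin_succ.2 ⟨div_pos hk₂ hTpos, fun i => div_pos (hcK i) hTpos⟩⟩,
    Fin.forall_fin_succ.2 ⟨hx₁, Fin.forall_fin_succ.2 ⟨fun j => ?_, hy⟩⟩,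
    Fin.forall_fin_succ.2 ⟨hdist, Fin.forall_fin_succ.2 ⟨hclose k₂' x₂ hk₂pos ?_,
      fun i => hclose _ _ (hK i) ((hy' i).trans_le ?_)⟩⟩, ?_, ?_,
    Fin.forall_fin_succ.2 ⟨fun h => by simp at h, Fin.forall_fin_succ.2
      ⟨fun h => by simp at h, fun i _ => hδW (K i) (y i) (hK i) (fun j => ?_)
        ((hy' i).trans_le hδδ₀)⟩⟩, fun _ => ?_⟩
  · obtain ⟨z, hz⟩ := hx₁ j
    refine ⟨M j - z, ?_⟩
    have : (k₂' : ℚ) ≠ 0 := by positivity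
    simp only [Fin.cons_zero, Fin.cons_succ, hx₂]
    push_cast
    rw [mul_div_cancel₀ _ this, hz]
    ring
  · rw [hx₂err]
    exact (norm_add_le d v).trans_lt (by linarith)
  · linarith [norm_nonneg v]
  · funext j
    simp only [Fin.sum_univ_succ, Fin.cons_zero, Fin.cons_succ, Pi.smul_apply,
      Finset.sum_apply, smul_eq_mul]
    have hj := congrFun hsum j
    simp only [hey, Pi.add_apply, Finset.sum_apply, Pi.smul_apply, Pi.sub_apply, smul_eq_mul,
      Pi.zero_apply, hd] at hj
    have h1 : ∑ i, c i * (K i * (ratToReal (y i) j - x j)) =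
        ∑ i, c i * K i * ratToReal (y i) j - (∑ i, c i * K i) * x j := by
      rw [Finset.sum_mul, ← Finset.sum_sub_distrib]
      exact Finset.sum_congr rfl fun i _ => by ring
    have h2 : ∑ i, c i * K i / T * ratToReal (y i) j =
        (∑ i, c i * K i * ratToReal (y i) j) / T := by
      rw [Finset.sum_div]
      exact Finset.sum_congr rfl fun i _ => by ring
    rw [h1] at hj
    have hx₂j := hx₂eq j
    rw [h2, div_mul_eq_mul_div, div_mul_eq_mul_div, hx₂j, ← add_div, ← add_div,
      eq_div_iff hTpos.ne', hT]
    linarith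
  · simp only [Fin.sum_univ_succ, Fin.cons_zero, Fin.cons_succ]
    rw [← Finset.sum_div, ← add_div, ← add_div, div_eq_one_iff_eq hTpos.ne', hT]
    ring
  · obtain ⟨z, hz⟩ := hy i j
    exact ⟨k * z, by exact_mod_cast hz⟩
  · change ‖x - ((k₁ : ℝ) / ((k₁ : ℝ) + (k₂' : ℝ))) • ratToReal x₁
      - ((k₂' : ℝ) / ((k₁ : ℝ) + (k₂' : ℝ))) • ratToReal x₂‖ < (η : ℝ) / ((k₁ : ℝ) + (k₂' : ℝ))
    have hξ : x - ((k₁ : ℝ) / ((k₁ : ℝ) + (k₂' : ℝ))) • ratToReal x₁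
        - ((k₂' : ℝ) / ((k₁ : ℝ) + (k₂' : ℝ))) • ratToReal x₂ =
        (-((k₁ : ℝ) + k₂')⁻¹) • d := by
      funext j
      have := hx₂eq j
      simp only [hd, Pi.smul_apply, Pi.sub_apply, smul_eq_mul]
      field_simp
      linarith
    rw [hξ, norm_smul, norm_neg, norm_inv, Real.norm_of_nonneg hN'.le, inv_mul_eq_div]
    gcongr
    linarith
end
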